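/- In PG(n,q), with n ≥ 4, q ≥ 16 and q = p^h a square prime power, and 2 ≤ 2t ≤ n, every (n−t)-blocking set K of type (a,b,c)_{n-1} with a = C_{n−2t−1,2t−2}, b = C_{n−2t−2,2t} and c = C_{n−2t−1,2t−1} is an (n−2t−1,2t)-Baer cone. Moreover, if t = 1 the same conclusion holds for all square prime powers q ≥ 4. -/

import Mathlib

open Module Set

noncomputable section

variable (F : Type) [Field F]

/-- The point set of `PG(n,q)`: the projectivization of `GF(q)^{n+1}`. -/
abbrev PGPoint (n : ℕ) := Projectivization F (Fin (n + 1) → F)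

/-- The set of points of the projective space lying in (the projectivization of)
a linear subspace `W`. A `d`-dimensional projective subspace corresponds to a
submodule `W` with `finrank F W = d + 1`; hyperplanes correspond to `finrank F W = n`. -/
def projSet (n : ℕ) (W : Submodule F (Fin (n + 1) → F)) : Set (PGPoint F n) :=
  {x | x.submodule ≤ W}

/-- `θ_m = (q^{m+1} - 1)/(q - 1)`, the number of points of `PG(m,q)`. -/
def theta (q m : ℕ) : ℕ := (q ^ (m + 1) - 1) / (q - 1)

/-- `K` is of type `(a,b,c)_{n-1}`: every hyperplane meets `K` in `a`, `b` or `c`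
points, and each of the three values is attained by some hyperplane. -/
def IsType3 (n : ℕ) (K : Set (PGPoint F n)) (a b c : ℕ) : Prop :=
  (∀ W : Submodule F (Fin (n + 1) → F), finrank F W = n →
      (K ∩ projSet F n W).ncard = a ∨ (K ∩ projSet F n W).ncard = b ∨
        (K ∩ projSet F n W).ncard = c) ∧
  (∃ W : Submodule F (Fin (n + 1) → F), finrank F W = n ∧ (K ∩ projSet F n W).ncard = a) ∧
  (∃ W : Submodule F (Fin (n + 1) → F), finrank F W = n ∧ (K ∩ projSet F n W).ncard = b) ∧
  (∃ W : Submodule F (Fin (n + 1) → F), finrank F W = n ∧ (K ∩ projSet F n W).ncard = c)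

/-- `tnum K m`: the number of hyperplanes meeting `K` in exactly `m` points. -/
def tnum (n : ℕ) (K : Set (PGPoint F n)) (m : ℕ) : ℕ :=
  {W : Submodule F (Fin (n + 1) → F) | finrank F W = n ∧ (K ∩ projSet F n W).ncard = m}.ncard

/-- `K` blocks every `t`-dimensional projective subspace of `PG(n,q)`,
i.e. `K` is an `(n-t)`-blocking set. -/
def BlocksDim (n t : ℕ) (K : Set (PGPoint F n)) : Prop :=
  ∀ W : Submodule F (Fin (n + 1) → F), finrank F W = t + 1 → (K ∩ projSet F n W).Nonempty

/-- `C_{vr-1, s} = ((√q)^{s+1}-1)/(√q-1) · q^{vr} + θ_{vr-1}`, the number of points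
of an `(vr-1, s)`-Baer cone; here `vr` is the linear rank of the vertex (projective
dimension of the vertex plus one), so that the convention `C_{-1,s}` corresponds
to `vr = 0`, and `sq` denotes `√q`. -/
def Cnum (q sq vr s : ℕ) : ℕ := (sq ^ (s + 1) - 1) / (sq - 1) * q ^ vr + (q ^ vr - 1) / (q - 1)

/-- `B` is an `s`-dimensional Baer subgeometry with respect to the subfield `F₀`
(of order `√q`): the set of points whose representative vectors are the nonzero
`F₀`-linear combinations of `s+1` vectors spanning an `(s+1)`-dimensional
`F`-subspace (equivalently, the nonzero vectors of an `(s+1)`-dimensional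
`F₀`-subspace whose `F`-span has `F`-dimension `s+1`). -/
def IsBaerSubgeo (n : ℕ) (F₀ : Subfield F) (s : ℕ) (B : Set (PGPoint F n)) : Prop :=
  ∃ v : Fin (s + 1) → (Fin (n + 1) → F),
    LinearIndependent F v ∧
    B = {x | ∃ (c : Fin (s + 1) → F) (_ : ∀ i, c i ∈ F₀) (hne : (∑ i, c i • v i) ≠ 0),
          x = Projectivization.mk F (∑ i, c i • v i) hne}

/-- `K` is an `(vr-1, s)`-Baer cone: there are a vertex subspace `Wv` of linear rank `vr`
and a complementary subspace `Wb` of linear rank `n+1-vr` disjoint from it such that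
`K ∩ Wb` is an `s`-dimensional Baer subgeometry and `K` is the union of the vertex,
the base, and all points on lines joining a point of the vertex to a point of the base. -/
def IsBaerCone (n : ℕ) (F₀ : Subfield F) (vr s : ℕ) (K : Set (PGPoint F n)) : Prop :=
  ∃ Wv Wb : Submodule F (Fin (n + 1) → F),
    finrank F Wv = vr ∧ finrank F Wb = n + 1 - vr ∧ Wv ⊓ Wb = ⊥ ∧
    IsBaerSubgeo F n F₀ s (K ∩ projSet F n Wb) ∧
    K = projSet F n Wv ∪ (K ∩ projSet F n Wb) ∪
      ⋃ y ∈ K ∩ projSet F n Wb, ⋃ x ∈ projSet F n Wv,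
        projSet F n (x.submodule ⊔ y.submodule)

section Counting

set_option linter.unusedSectionVars false

open scoped LinearAlgebra.Projectivization
open Classical in
/-- The number of points of a finite point set lying in a subspace. -/
def cnt {L E : Type*} [Field L] [AddCommGroup E] [Module L E]
    (K : Finset (ℙ L E)) (Z : Submodule L E) : ℕ :=
  (K.filter fun P => P.submodule ≤ Z).card

/-- The geometric sum `1 + x + ⋯ + x ^ (d - 1)`. -/
def gs (x d : ℕ) : ℕ := ∑ i ∈ Finset.range d, x ^ i

theorem gs_zero (x : ℕ) : gs x 0 = 0 := by simp [gs]

theorem gs_one (x : ℕ) : gs x 1 = 1 := by simp [gs]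

theorem gs_succ (x d : ℕ) : gs x (d + 1) = gs x d + x ^ d := by
  simp [gs, Finset.sum_range_succ]

theorem gs_succ' (x d : ℕ) : gs x (d + 1) = x * gs x d + 1 := by
  simp only [gs, Finset.sum_range_succ', Finset.mul_sum, pow_succ', pow_zero]

theorem gs_add (x d e : ℕ) : gs x (d + e) = gs x d + x ^ d * gs x e := by
  induction e with
  | zero => simp [gs_zero]
  | succ e ih => rw [← add_assoc, gs_succ, gs_succ, ih]; ring

theorem gs_int (x d : ℕ) : ((x : ℤ) - 1) * gs x d = (x : ℤ) ^ d - 1 := by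
  rw [gs]; push_cast; exact mul_geom_sum _ _

theorem gs_mono (x : ℕ) : Monotone (gs x) := by
  apply monotone_nat_of_le_succ
  intro d
  rw [gs_succ]; omega

theorem gs_strictMono {x : ℕ} (hx : 0 < x) : StrictMono (gs x) := by
  apply strictMono_nat_of_lt_succ
  intro d
  rw [gs_succ]
  have := pow_pos hx d
  omega

variable {L : Type*} [Field L] [Fintype L] {E : Type*} [AddCommGroup E] [Module L E]
  [FiniteDimensional L E]

instance finite_projectivization : Finite (ℙ L E) :=
  have : Finite E := Module.finite_of_finite L
  inferInstance

/-- The finite set of points of a subspace. -/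
def pts (Z : Submodule L E) : Finset (ℙ L E) :=
  (Set.toFinite {P : ℙ L E | P.submodule ≤ Z}).toFinset

theorem submodule_le_iff_rep {P : ℙ L E} {Z : Submodule L E} : P.submodule ≤ Z ↔ P.rep ∈ Z := by
  rw [P.submodule_eq, Submodule.span_singleton_le_iff_mem]

@[simp] theorem mem_pts {P : ℙ L E} {Z : Submodule L E} : P ∈ pts Z ↔ P.submodule ≤ Z := by
  simp [pts]

theorem card_pts (Z : Submodule L E) : (pts Z).card = gs (Fintype.card L) (finrank L Z) := by
  have h := Projectivization.card_of_finrank L Z rfl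
  rw [gs, ← Nat.card_eq_fintype_card, ← h]
  have : Set.range (Projectivization.map Z.subtype Z.injective_subtype) =
      {P : ℙ L E | P.submodule ≤ Z} := by
    ext P
    constructor
    · rintro ⟨Q, rfl⟩
      induction Q using Projectivization.ind with
      | h v hv => simp [Projectivization.map_mk, Projectivization.submodule_mk]
    · intro hP
      have hP' : P.rep ∈ Z := submodule_le_iff_rep.1 hP
      refine ⟨Projectivization.mk L ⟨P.rep, hP'⟩ (by
        intro h; exact P.rep_nonzero (congrArg Subtype.val h)), ?_⟩
      simp [Projectivization.map_mk, Projectivization.mk_rep]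
  rw [pts, ← Set.ncard_eq_toFinset_card _ _, ← this, ← Set.image_univ,
    Set.ncard_image_of_injective _ (Projectivization.map_injective _ _), Set.ncard_univ]

/-- Incidence of a hyperplane, given as a point of the dual space, with a point. -/
theorem dual_submodule_le_iff {h : ℙ L (Dual L E)} {Z : Submodule L E} :
    h.submodule ≤ Z.dualAnnihilator ↔ Z ≤ h.submodule.dualCoannihilator :=
  Submodule.le_dualAnnihilator_iff_le_dualCoannihilator

theorem finrank_dualAnn (Z : Submodule L E) :
    finrank L Z.dualAnnihilator = finrank L E - finrank L Z := by
  have := Subspace.finrank_add_finrank_dualAnnihilator_eq Z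
  omega

theorem finrank_hyp (h : ℙ L (Dual L E)) :
    finrank L h.submodule.dualCoannihilator + 1 = finrank L E := by
  have := Subspace.finrank_add_finrank_dualCoannihilator_eq h.submodule
  rw [h.finrank_submodule] at this
  omega

/-- The number of points of `K` on a hyperplane. -/
def hcnt (K : Finset (ℙ L E)) (h : ℙ L (Dual L E)) : ℕ :=
  cnt K h.submodule.dualCoannihilator

theorem card_hyps (Z : Submodule L E) :
    (pts Z.dualAnnihilator).card = gs (Fintype.card L) (finrank L E - finrank L Z) := by
  rw [card_pts, finrank_dualAnn]

theorem finrank_sup_point {P : ℙ L E} {Z : Submodule L E} (h : ¬ P.submodule ≤ Z) :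
    finrank L (Z ⊔ P.submodule : Submodule L E) = finrank L Z + 1 := by
  have h1 := Submodule.finrank_sup_add_finrank_inf_eq Z P.submodule
  have h2 : Z ⊓ P.submodule = ⊥ := by
    by_contra hne
    have h3 : finrank L (Z ⊓ P.submodule : Submodule L E) ≠ 0 := by
      rwa [Ne, Submodule.finrank_eq_zero]
    have h4 : Z ⊓ P.submodule = P.submodule := by
      apply Submodule.eq_of_le_of_finrank_le inf_le_right
      rw [P.finrank_submodule]; omega
    exact h (inf_eq_right.1 h4)
  rw [h2, P.finrank_submodule, finrank_bot] at h1
  omega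

theorem cnt_le_card_pts (K : Finset (ℙ L E)) (Z : Submodule L E) :
    cnt K Z ≤ gs (Fintype.card L) (finrank L Z) := by
  rw [← card_pts]
  classical
  apply Finset.card_le_card
  intro P
  simp only [Finset.mem_filter, mem_pts]
  exact And.right

theorem cnt_mono (K : Finset (ℙ L E)) {Z W : Submodule L E} (h : Z ≤ W) : cnt K Z ≤ cnt K W := by
  classical
  apply Finset.card_le_card
  intro P
  simp only [Finset.mem_filter]
  exact fun hp => ⟨hp.1, hp.2.trans h⟩

theorem cnt_top (K : Finset (ℙ L E)) : cnt K ⊤ = K.card := by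
  classical
  rw [cnt, Finset.filter_true_of_mem fun _ _ => le_top]

/-- The number of hyperplanes through a subspace and a point outside it. -/
theorem sum_hcnt (K : Finset (ℙ L E)) (Z : Submodule L E) (j : ℕ)
    (hj : finrank L Z + (j + 1) = finrank L E) :
    ∑ h ∈ pts Z.dualAnnihilator, hcnt K h =
      cnt K Z * (Fintype.card L) ^ j + K.card * gs (Fintype.card L) j := by
  classical
  have h1 : ∑ h ∈ pts Z.dualAnnihilator, hcnt K h =
      ∑ P ∈ K, ((pts Z.dualAnnihilator).filter
        fun h => P.submodule ≤ h.submodule.dualCoannihilator).card := by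
    have := Finset.sum_card_bipartiteAbove_eq_sum_card_bipartiteBelow
      (fun P h => P.submodule ≤ (h : ℙ L (Dual L E)).submodule.dualCoannihilator) (s := K)
        (t := pts Z.dualAnnihilator)
    simp only [Finset.bipartiteAbove, Finset.bipartiteBelow] at this
    rw [this]
    simp only [hcnt, cnt]
  have h2 : ∀ P ∈ K, ((pts Z.dualAnnihilator).filter
        fun h => P.submodule ≤ h.submodule.dualCoannihilator).card =
      (if P.submodule ≤ Z then (Fintype.card L) ^ j else 0) + gs (Fintype.card L) j := by
    intro P _
    have h3 : ((pts Z.dualAnnihilator).filter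
        fun h => P.submodule ≤ h.submodule.dualCoannihilator) =
        pts (Z ⊔ P.submodule).dualAnnihilator := by
      ext h
      simp only [Finset.mem_filter, mem_pts, dual_submodule_le_iff, sup_le_iff]
    rw [h3, card_hyps]
    split_ifs with hP
    · rw [sup_eq_left.2 hP, show finrank L E - finrank L Z = j + 1 by omega, gs_succ, add_comm]
    · rw [finrank_sup_point hP, show finrank L E - (finrank L Z + 1) = j by omega, zero_add]
  rw [h1, Finset.sum_congr rfl h2, Finset.sum_add_distrib, Finset.sum_const, smul_eq_mul,
    ← Finset.sum_filter, Finset.sum_const, smul_eq_mul, cnt]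

end Counting

section Greedy

set_option linter.unusedSectionVars false

open scoped LinearAlgebra.Projectivization

variable {L : Type*} [Field L] [Fintype L] {E : Type*} [AddCommGroup E] [Module L E]
  [FiniteDimensional L E]

theorem sup_point_exchange {P Q : ℙ L E} {S : Submodule L E} (hP : ¬ P.submodule ≤ S)
    (hQ : ¬ Q.submodule ≤ S) (h : P.submodule ≤ S ⊔ Q.submodule) :
    Q.submodule ≤ S ⊔ P.submodule := by
  have h1 : S ⊔ P.submodule = S ⊔ Q.submodule := by
    apply Submodule.eq_of_le_of_finrank_le (sup_le le_sup_left h)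
    rw [finrank_sup_point hP, finrank_sup_point hQ]
  rw [h1]
  exact le_sup_right

theorem point_eq_of_le {P Q : ℙ L E} (h : P.submodule ≤ Q.submodule) : P = Q := by
  apply Projectivization.submodule_injective
  apply Submodule.eq_of_le_of_finrank_le h
  rw [P.finrank_submodule, Q.finrank_submodule]

theorem cnt_point {K : Finset (ℙ L E)} {P : ℙ L E} (hP : P ∈ K) : cnt K P.submodule = 1 := by
  classical
  rw [cnt, Finset.card_eq_one]
  refine ⟨P, ?_⟩
  ext Q
  simp only [Finset.mem_filter, Finset.mem_singleton]
  exact ⟨fun h => point_eq_of_le h.2, fun h => by subst h; exact ⟨hP, le_rfl⟩⟩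

theorem cnt_point_not_mem {K : Finset (ℙ L E)} {P : ℙ L E} (hP : P ∉ K) :
    cnt K P.submodule = 0 := by
  classical
  rw [cnt, Finset.card_eq_zero, Finset.filter_eq_empty_iff]
  intro Q hQ h
  exact hP (point_eq_of_le h ▸ hQ)

theorem cnt_eq_zero {K : Finset (ℙ L E)} {Z : Submodule L E} :
    cnt K Z = 0 ↔ ∀ P ∈ K, ¬ P.submodule ≤ Z := by
  classical
  rw [cnt, Finset.card_eq_zero, Finset.filter_eq_empty_iff]

theorem cnt_pos {K : Finset (ℙ L E)} {Z : Submodule L E} {P : ℙ L E} (hP : P ∈ K)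
    (h : P.submodule ≤ Z) : 0 < cnt K Z := by
  rw [Nat.pos_iff_ne_zero, Ne, cnt_eq_zero]
  push Not
  exact ⟨P, hP, h⟩

theorem exists_of_cnt_lt {K : Finset (ℙ L E)} {S W : Submodule L E} (h : cnt K S < cnt K W) :
    ∃ P ∈ K, P.submodule ≤ W ∧ ¬ P.submodule ≤ S := by
  classical
  by_contra! hc
  refine absurd h (not_lt.2 (Finset.card_le_card ?_))
  intro P
  simp only [Finset.mem_filter]
  exact fun hp => ⟨hp.1, hc P hp.1 hp.2⟩

theorem sum_cnt_sup (K : Finset (ℙ L E)) {S W : Submodule L E} (hSW : S ≤ W)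
    [DecidableEq (ℙ L E)] :
    ∑ Q ∈ pts W \ pts S, (cnt K (S ⊔ Q.submodule) - cnt K S) =
      (cnt K W - cnt K S) * (Fintype.card L) ^ finrank L S := by
  classical
  have hsub : ∀ T : Submodule L E, S ≤ T →
      cnt K T - cnt K S = ((K.filter fun P => ¬ P.submodule ≤ S).filter
        fun P => P.submodule ≤ T).card := by
    intro T hT
    have h1 : cnt K T = cnt K S + ((K.filter fun P => ¬ P.submodule ≤ S).filter
        fun P => P.submodule ≤ T).card := by
      rw [cnt, cnt, ← Finset.card_filter_add_card_filter_not
        (s := K.filter fun P => P.submodule ≤ T) (fun P => P.submodule ≤ S),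
        Finset.filter_filter, Finset.filter_filter, Finset.filter_filter]
      congr 2
      · apply Finset.filter_congr
        intro P _
        exact ⟨fun h => h.2, fun h => ⟨h.trans hT, h⟩⟩
      · apply Finset.filter_congr
        intro P _
        exact and_comm
    omega
  rw [hsub W hSW]
  have h1 : ∑ Q ∈ pts W \ pts S, (cnt K (S ⊔ Q.submodule) - cnt K S) =
      ∑ Q ∈ pts W \ pts S, (((K.filter fun P => ¬ P.submodule ≤ S).filter
        fun P => P.submodule ≤ W).filter fun P => P.submodule ≤ S ⊔ Q.submodule).card := by
    apply Finset.sum_congr rfl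
    intro Q hQ
    rw [hsub _ le_sup_left]
    simp only [Finset.mem_sdiff, mem_pts] at hQ
    congr 1
    rw [Finset.filter_filter (s := K.filter fun P => ¬ P.submodule ≤ S)]
    apply Finset.filter_congr
    intro P _
    exact ⟨fun h => ⟨h.trans (sup_le hSW hQ.1), h⟩, fun h => h.2⟩
  have h2 := Finset.sum_card_bipartiteAbove_eq_sum_card_bipartiteBelow
    (fun (Q P : ℙ L E) => P.submodule ≤ S ⊔ Q.submodule) (s := pts W \ pts S)
    (t := (K.filter fun P => ¬ P.submodule ≤ S).filter fun P => P.submodule ≤ W)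
  simp only [Finset.bipartiteAbove, Finset.bipartiteBelow] at h2
  rw [h1, h2, Finset.sum_const_nat]
  intro P hP
  simp only [Finset.mem_filter] at hP
  have h3 : ((pts W \ pts S).filter fun Q => P.submodule ≤ S ⊔ Q.submodule) =
      pts (S ⊔ P.submodule) \ pts S := by
    ext Q
    simp only [Finset.mem_filter, Finset.mem_sdiff, mem_pts]
    constructor
    · rintro ⟨⟨hQ1, hQ2⟩, h⟩
      exact ⟨sup_point_exchange hP.1.2 hQ2 h, hQ2⟩
    · rintro ⟨h, hQ⟩
      exact ⟨⟨h.trans (sup_le hSW hP.2), hQ⟩, sup_point_exchange hQ hP.1.2 h⟩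
  rw [h3, Finset.card_sdiff_of_subset, card_pts, card_pts, finrank_sup_point hP.1.2, gs_succ]
  · omega
  · intro Q
    simp only [mem_pts]
    exact fun h => h.trans le_sup_left

theorem card_pts_sdiff {S W : Submodule L E} (hSW : S ≤ W) [DecidableEq (ℙ L E)] :
    (pts W \ pts S).card =
      Fintype.card L ^ finrank L S * gs (Fintype.card L) (finrank L W - finrank L S) := by
  have h0 := Submodule.finrank_mono hSW
  rw [Finset.card_sdiff_of_subset, card_pts, card_pts]
  · have := gs_add (Fintype.card L) (finrank L S) (finrank L W - finrank L S)
    rw [Nat.add_sub_cancel' h0] at this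
    omega
  · intro Q
    simp only [mem_pts]
    exact fun h => h.trans hSW

/-- A subspace extends by one dimension inside `W` picking up at most the average
number of new points. -/
theorem exists_extension (K : Finset (ℙ L E)) {S W : Submodule L E} (hSW : S ≤ W)
    (hlt : finrank L S < finrank L W) :
    ∃ Q : ℙ L E, Q.submodule ≤ W ∧ ¬ Q.submodule ≤ S ∧
      (cnt K (S ⊔ Q.submodule) - cnt K S) *
        gs (Fintype.card L) (finrank L W - finrank L S) ≤ cnt K W - cnt K S := by
  classical
  by_contra! hc
  have hq : 0 < Fintype.card L := Fintype.card_pos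
  have h1 := sum_cnt_sup K hSW
  have h2 := card_pts_sdiff hSW
  have hg : 0 < gs (Fintype.card L) (finrank L W - finrank L S) := by
    have := gs_strictMono hq (show 0 < finrank L W - finrank L S by omega)
    rwa [gs_zero] at this
  have hne : (pts W \ pts S).Nonempty := by
    rw [← Finset.card_pos, h2]
    exact Nat.mul_pos (pow_pos hq _) hg
  have h3 : ∑ Q ∈ pts W \ pts S, (cnt K W - cnt K S) <
      ∑ Q ∈ pts W \ pts S, (cnt K (S ⊔ Q.submodule) - cnt K S) *
        gs (Fintype.card L) (finrank L W - finrank L S) := by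
    apply Finset.sum_lt_sum_of_nonempty hne
    intro Q hQ
    simp only [Finset.mem_sdiff, mem_pts] at hQ
    exact hc Q hQ.1 hQ.2
  rw [← Finset.sum_mul, h1, Finset.sum_const, h2, smul_eq_mul] at h3
  apply lt_irrefl _ (h3.trans_eq _)
  ring

/-- A subspace missing `K` extends to a larger one missing `K` when `K` is small. -/
theorem exists_extension_disjoint (K : Finset (ℙ L E)) (W : Submodule L E) (d : ℕ)
    (hsmall : cnt K W < gs (Fintype.card L) (finrank L W + 1 - d)) (hd : d ≤ finrank L W)
    (S : Submodule L E) (hSW : S ≤ W) (hS : cnt K S = 0) (hSd : finrank L S ≤ d) :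
    ∃ T, S ≤ T ∧ T ≤ W ∧ finrank L T = d ∧ cnt K T = 0 := by
  obtain ⟨j, hj⟩ := Nat.exists_eq_add_of_le hSd
  induction j generalizing S with
  | zero => exact ⟨S, le_rfl, hSW, by omega, hS⟩
  | succ j ih =>
    obtain ⟨Q, hQW, hQS, h⟩ := exists_extension K hSW (by omega)
    have h0 : cnt K (S ⊔ Q.submodule) = 0 := by
      by_contra hne
      have h1 : 1 ≤ cnt K (S ⊔ Q.submodule) - cnt K S := by omega
      have h2 := Nat.mul_le_mul_right (gs (Fintype.card L) (finrank L W - finrank L S)) h1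
      have h3 := gs_mono (Fintype.card L)
        (show finrank L W + 1 - d ≤ finrank L W - finrank L S by omega)
      omega
    have hfr := finrank_sup_point hQS
    obtain ⟨T, hT⟩ := ih (S ⊔ Q.submodule) (sup_le hSW hQW) h0 (by omega) (by omega)
    exact ⟨T, le_sup_left.trans hT.1, hT.2⟩

theorem sum_hcnt_all (K : Finset (ℙ L E)) (n : ℕ) (hn : finrank L E = n + 1) :
    ∑ h ∈ pts (⊤ : Submodule L (Dual L E)), hcnt K h = K.card * gs (Fintype.card L) n := by
  have h := sum_hcnt K ⊥ n (by rw [finrank_bot]; omega)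
  rw [Submodule.dualAnnihilator_bot] at h
  rw [h, cnt_eq_zero.2, zero_mul, zero_add]
  intro P _ hP
  exact P.rep_nonzero ((Submodule.mem_bot L).1 (submodule_le_iff_rep.1 hP))

theorem card_hyps_all (n : ℕ) (hn : finrank L E = n + 1) :
    (pts (⊤ : Submodule L (Dual L E))).card = gs (Fintype.card L) (n + 1) := by
  rw [card_pts, finrank_top, Subspace.dual_finrank_eq, hn]

theorem sum_hcnt_sq (K : Finset (ℙ L E)) (n : ℕ) (hn : finrank L E = n + 2) :
    ∑ h ∈ pts (⊤ : Submodule L (Dual L E)), hcnt K h ^ 2 =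
      K.card * (Fintype.card L ^ n + K.card * gs (Fintype.card L) n) := by
  classical
  have h1 : ∀ h ∈ pts (⊤ : Submodule L (Dual L E)), hcnt K h ^ 2 =
      ∑ P ∈ K, if P.submodule ≤ h.submodule.dualCoannihilator then hcnt K h else 0 := by
    intro h _
    rw [← Finset.sum_filter, Finset.sum_const, smul_eq_mul, pow_two]
    congr 1
  rw [Finset.sum_congr rfl h1, Finset.sum_comm, Finset.sum_const_nat]
  intro P hP
  rw [← Finset.sum_filter]
  have h2 : ((pts (⊤ : Submodule L (Dual L E))).filter
      fun h => P.submodule ≤ h.submodule.dualCoannihilator) = pts P.submodule.dualAnnihilator := by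
    ext h
    simp only [Finset.mem_filter, mem_pts, dual_submodule_le_iff, le_top, true_and]
  rw [h2, sum_hcnt K P.submodule n (by rw [P.finrank_submodule]; omega), cnt_point hP, one_mul]

end Greedy

section BoseBurton

set_option linter.unusedSectionVars false

open scoped LinearAlgebra.Projectivization

variable {L : Type*} [Field L] [Fintype L] {E : Type*} [AddCommGroup E] [Module L E]
  [FiniteDimensional L E]

theorem two_le_cnt {K : Finset (ℙ L E)} {Z : Submodule L E} {P Q : ℙ L E} (hP : P ∈ K)
    (hQ : Q ∈ K) (hPQ : P ≠ Q) (hPZ : P.submodule ≤ Z) (hQZ : Q.submodule ≤ Z) :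
    2 ≤ cnt K Z := by
  classical
  rw [cnt, ← Finset.card_pair hPQ]
  apply Finset.card_le_card
  intro R
  simp only [Finset.mem_insert, Finset.mem_singleton, Finset.mem_filter]
  rintro (rfl | rfl)
  · exact ⟨hP, hPZ⟩
  · exact ⟨hQ, hQZ⟩

theorem minimal_blocking_closed (D : Finset (ℙ L E)) (r e : ℕ) (hN : finrank L E = r + e)
    (hcard : D.card = gs (Fintype.card L) r)
    (hblock : ∀ W : Submodule L E, finrank L W = e + 1 → 0 < cnt D W)
    {x y z : ℙ L E} (hx : x ∈ D) (hy : y ∈ D) (hz : z.submodule ≤ x.submodule ⊔ y.submodule) :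
    z ∈ D := by
  classical
  by_contra hzD
  have hxy : x ≠ y := by
    rintro rfl
    rw [sup_idem] at hz
    exact hzD (point_eq_of_le hz ▸ hx)
  have hz0 : cnt D z.submodule = 0 := cnt_point_not_mem hzD
  have hq : 0 < Fintype.card L := Fintype.card_pos
  rcases Nat.eq_zero_or_pos e with rfl | he
  · have := hblock z.submodule z.finrank_submodule
    omega
  obtain ⟨S, hzS, -, hSe, hS0⟩ := exists_extension_disjoint D ⊤ e
    (by
      rw [cnt_top, hcard, finrank_top, hN, show r + e + 1 - e = r + 1 by omega]
      exact gs_strictMono hq (Nat.lt_succ_self r))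
    (by rw [finrank_top, hN]; omega) z.submodule le_top hz0 (by rw [z.finrank_submodule]; omega)
  have hxS : ¬ x.submodule ≤ S := cnt_eq_zero.1 hS0 x hx
  have h1 := sum_cnt_sup D (le_top : S ≤ ⊤)
  have h2 := card_pts_sdiff (le_top : S ≤ ⊤)
  rw [finrank_top, hN, hSe, show r + e - e = r by omega] at h2
  rw [cnt_top, hS0, hcard, hSe] at h1
  have h3 : ∑ Q ∈ pts ⊤ \ pts S, 1 <
      ∑ Q ∈ pts ⊤ \ pts S, (cnt D (S ⊔ Q.submodule) - 0) := by
    apply Finset.sum_lt_sum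
    · intro Q hQ
      simp only [Finset.mem_sdiff, mem_pts] at hQ
      have := hblock (S ⊔ Q.submodule) (by rw [finrank_sup_point hQ.2, hSe])
      omega
    · refine ⟨x, ?_, ?_⟩
      · simp only [Finset.mem_sdiff, mem_pts]
        exact ⟨le_top, hxS⟩
      · have hyz : y.submodule ≤ x.submodule ⊔ z.submodule := by
          apply sup_point_exchange (S := x.submodule) (P := z) (Q := y) _ _ hz
          · intro h
            exact hzD (point_eq_of_le h ▸ hx)
          · intro h
            exact hxy (point_eq_of_le h).symm
        have := two_le_cnt hx hy hxy (le_sup_right : _ ≤ S ⊔ x.submodule)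
          (hyz.trans (sup_le le_sup_right (hzS.trans le_sup_left)))
        omega
  rw [Finset.sum_const, h2, h1, smul_eq_mul, Nat.sub_zero] at h3
  apply lt_irrefl _ (h3.trans_eq _)
  ring

/-- A point set with the size of an `r`-dimensional subspace meeting every subspace of
complementary dimension plus one is a subspace. -/
theorem minimal_blocking_eq_pts (D : Finset (ℙ L E)) (r e : ℕ) (hN : finrank L E = r + e)
    (hcard : D.card = gs (Fintype.card L) r)
    (hblock : ∀ W : Submodule L E, finrank L W = e + 1 → 0 < cnt D W) :
    ∃ V : Submodule L E, finrank L V = r ∧ D = pts V := by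
  let V : Submodule L E :=
    { carrier := {v | ∀ h : v ≠ 0, Projectivization.mk L v h ∈ D}
      zero_mem' := fun h => absurd rfl h
      add_mem' := by
        intro v w hv hw h
        by_cases hv0 : v = 0
        · subst hv0
          simp only [zero_add] at h ⊢
          exact hw h
        by_cases hw0 : w = 0
        · subst hw0
          simp only [add_zero] at h ⊢
          exact hv h
        refine minimal_blocking_closed D r e hN hcard hblock (hv hv0) (hw hw0) ?_
        rw [Projectivization.submodule_mk, Projectivization.submodule_mk,
          Projectivization.submodule_mk, Submodule.span_singleton_le_iff_mem]
        exact Submodule.add_mem_sup (Submodule.mem_span_singleton_self v)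
          (Submodule.mem_span_singleton_self w)
      smul_mem' := by
        intro c v hv h
        have hv0 : v ≠ 0 := by
          rintro rfl
          exact h (smul_zero c)
        have : Projectivization.mk L (c • v) h = Projectivization.mk L v hv0 := by
          rw [Projectivization.mk_eq_mk_iff']
          exact ⟨c, rfl⟩
        rw [this]
        exact hv hv0 }
  have hD : D = pts V := by
    ext P
    rw [mem_pts, submodule_le_iff_rep]
    change P ∈ D ↔ ∀ h : P.rep ≠ 0, Projectivization.mk L P.rep h ∈ D
    constructor
    · intro hP h
      rwa [Projectivization.mk_rep]
    · intro h
      have := h P.rep_nonzero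
      rwa [Projectivization.mk_rep] at this
  refine ⟨V, ?_, hD⟩
  apply (gs_strictMono (x := Fintype.card L) Fintype.card_pos).injective
  rw [← card_pts, ← hD, hcard]

end BoseBurton

section Spectrum

set_option linter.unusedSectionVars false

open scoped LinearAlgebra.Projectivization

variable {L : Type*} [Field L] [Fintype L] {E : Type*} [AddCommGroup E] [Module L E]
  [FiniteDimensional L E]

theorem cnt_filter_not_add (K : Finset (ℙ L E)) (H : Submodule L E)
    [DecidablePred fun P : ℙ L E => ¬ P.submodule ≤ H] :
    cnt K H + (K.filter fun P => ¬ P.submodule ≤ H).card = K.card := by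
  classical
  rw [cnt, ← Finset.card_filter_add_card_filter_not (s := K) (fun P => P.submodule ≤ H)]

/-- A blocking set with a small hyperplane section is large. -/
theorem card_ge_of_blocking (K : Finset (ℙ L E)) (n t : ℕ) (hn : finrank L E = n + 1)
    (ht : t ≤ n) (hblock : ∀ W : Submodule L E, finrank L W = t + 1 → 0 < cnt K W)
    (H : Submodule L E) (hH : finrank L H = n)
    (hsmall : cnt K H < gs (Fintype.card L) (n + 1 - t)) :
    cnt K H + Fintype.card L ^ (n - t) ≤ K.card := by
  classical
  have hq : 0 < Fintype.card L := Fintype.card_pos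
  have hbot : cnt K ⊥ = 0 := by
    have := cnt_le_card_pts K ⊥
    rw [finrank_bot, gs_zero] at this
    omega
  obtain ⟨S, -, hSH, hSt, hS0⟩ := exists_extension_disjoint K H t (by rwa [hH]) (by omega)
    ⊥ bot_le hbot (by rw [finrank_bot]; omega)
  set K' := K.filter fun P => ¬ P.submodule ≤ H with hK'
  have hcard : cnt K H + K'.card = K.card := cnt_filter_not_add K H
  have hS0' : cnt K' S = 0 := by
    rw [cnt_eq_zero]
    intro P hP
    exact cnt_eq_zero.1 hS0 P (Finset.mem_filter.1 hP).1
  have h1 := sum_cnt_sup K' (le_top : S ≤ ⊤)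
  rw [hS0', cnt_top, hSt] at h1
  have h2 := card_pts_sdiff (le_top : H ≤ ⊤)
  rw [finrank_top, hn, hH, Nat.add_sub_cancel_left, gs_one, mul_one] at h2
  have h3 : ∑ Q ∈ pts ⊤ \ pts H, 1 ≤ ∑ Q ∈ pts ⊤ \ pts S, (cnt K' (S ⊔ Q.submodule) - 0) := by
    refine (Finset.sum_le_sum ?_).trans (Finset.sum_le_sum_of_subset ?_)
    · intro Q hQ
      simp only [Finset.mem_sdiff, mem_pts] at hQ
      have hQS : ¬ Q.submodule ≤ S := fun h => hQ.2 (h.trans hSH)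
      have h4 := hblock (S ⊔ Q.submodule) (by rw [finrank_sup_point hQS, hSt])
      rw [← hS0] at h4
      obtain ⟨P, hPK, hPQ, hPS⟩ := exists_of_cnt_lt h4
      have hPH : ¬ P.submodule ≤ H := fun h =>
        hQ.2 ((sup_point_exchange hPS hQS hPQ).trans (sup_le hSH h))
      have := cnt_pos (K := K') (Finset.mem_filter.2 ⟨hPK, hPH⟩) hPQ
      omega
    · intro Q
      simp only [Finset.mem_sdiff, mem_pts]
      exact fun h => ⟨h.1, fun h' => h.2 (h'.trans hSH)⟩
  rw [h1, Finset.sum_const, h2, smul_eq_mul, mul_one, Nat.sub_zero,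
    show n = (n - t) + t by omega, pow_add] at h3
  have h4 := Nat.le_of_mul_le_mul_right h3 (pow_pos hq t)
  omega

theorem cnt_ge_of_blocking (K : Finset (ℙ L E)) (t : ℕ)
    (hblock : ∀ W : Submodule L E, finrank L W = t + 1 → 0 < cnt K W)
    (U : Submodule L E) (hU : t + 1 ≤ finrank L U) :
    gs (Fintype.card L) (finrank L U - t) ≤ cnt K U := by
  by_contra! h
  have hbot : cnt K ⊥ = 0 := by
    have := cnt_le_card_pts K ⊥
    rw [finrank_bot, gs_zero] at this
    omega
  obtain ⟨S, -, -, hSt, hS0⟩ := exists_extension_disjoint K U (t + 1)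
    (by rwa [show finrank L U + 1 - (t + 1) = finrank L U - t by omega]) hU
    ⊥ bot_le hbot (by rw [finrank_bot]; omega)
  have := hblock S hSt
  omega

theorem pencil_bound (K : Finset (ℙ L E)) {A B : ℙ L (Dual L E)} (hAB : A ≠ B) (c : ℕ)
    (hc : ∀ h, hcnt K h ≤ c) :
    ∃ U : Submodule L E, finrank L U + 2 = finrank L E ∧
      cnt K U * Fintype.card L + K.card + 2 * c ≤
        hcnt K A + hcnt K B + (Fintype.card L + 1) * c := by
  classical
  have hBA : ¬ B.submodule ≤ A.submodule := fun h => hAB (point_eq_of_le h).symm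
  have hfr := finrank_sup_point hBA
  rw [A.finrank_submodule] at hfr
  let U := (A.submodule ⊔ B.submodule).dualCoannihilator
  have hU : finrank L U + 2 = finrank L E := by
    have := Subspace.finrank_add_finrank_dualCoannihilator_eq (A.submodule ⊔ B.submodule)
    change finrank L (A.submodule ⊔ B.submodule).dualCoannihilator + 2 = _
    omega
  refine ⟨U, hU, ?_⟩
  have h1 := sum_hcnt K U 1 (by omega)
  have h2 := card_hyps U
  rw [show finrank L E - finrank L U = 2 by omega] at h2
  rw [pow_one, gs_one, mul_one] at h1
  have hA : A ∈ pts U.dualAnnihilator := by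
    rw [mem_pts, dual_submodule_le_iff]
    exact Submodule.dualCoannihilator_anti le_sup_left
  have hB : B ∈ pts U.dualAnnihilator := by
    rw [mem_pts, dual_submodule_le_iff]
    exact Submodule.dualCoannihilator_anti le_sup_right
  have h3 := Finset.sum_erase_add _ (fun h => hcnt K h) hA
  have hB' : B ∈ (pts U.dualAnnihilator).erase A := Finset.mem_erase.2 ⟨hAB.symm, hB⟩
  have h4 := Finset.sum_erase_add _ (fun h => hcnt K h) hB'
  have h5 : ∑ h ∈ ((pts U.dualAnnihilator).erase A).erase B, hcnt K h ≤
      (((pts U.dualAnnihilator).erase A).erase B).card * c := by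
    rw [← smul_eq_mul]
    exact Finset.sum_le_card_nsmul _ _ _ fun h _ => hc h
  have h6 := Finset.card_erase_add_one hA
  have h7 := Finset.card_erase_add_one hB'
  have h8 : gs (Fintype.card L) 2 = Fintype.card L + 1 := by
    rw [gs_succ', gs_one, mul_one]
  have h9 : (Fintype.card L + 1) * c =
      (((pts U.dualAnnihilator).erase A).erase B).card * c + 2 * c := by
    rw [← add_mul]
    congr 1
    omega
  omega

/-- The eigenvalue attached to a hyperplane. -/
def ev (K : Finset (ℙ L E)) (h : ℙ L (Dual L E)) : ℤ :=
  Fintype.card L * hcnt K h - K.card + 1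

theorem sum_ev (K : Finset (ℙ L E)) (n : ℕ) (hn : finrank L E = n + 1) :
    ((Fintype.card L : ℤ) - 1) * ∑ h ∈ pts (⊤ : Submodule L (Dual L E)), ev K h =
      (Fintype.card L : ℤ) ^ (n + 1) - (((Fintype.card L : ℤ) - 1) * K.card + 1) := by
  have h1 : (∑ h ∈ pts (⊤ : Submodule L (Dual L E)), (hcnt K h : ℤ)) =
      K.card * gs (Fintype.card L) n := by exact_mod_cast sum_hcnt_all K n hn
  have h0 := card_hyps_all (L := L) (E := E) n hn
  simp only [ev, Finset.sum_add_distrib, Finset.sum_sub_distrib, ← Finset.mul_sum, h1,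
    Finset.sum_const, h0, nsmul_eq_mul]
  linear_combination (Fintype.card L * K.card : ℤ) * gs_int (Fintype.card L) n -
    (K.card - 1 : ℤ) * gs_int (Fintype.card L) (n + 1)

theorem sum_ev_sq (K : Finset (ℙ L E)) (n : ℕ) (hn : finrank L E = n + 2) :
    ((Fintype.card L : ℤ) - 1) * ∑ h ∈ pts (⊤ : Submodule L (Dual L E)), ev K h ^ 2 =
      (((Fintype.card L : ℤ) - 1) * K.card + 1) *
      ((Fintype.card L : ℤ) ^ (n + 2) - (((Fintype.card L : ℤ) - 1) * K.card + 1)) := by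
  have h1 : (∑ h ∈ pts (⊤ : Submodule L (Dual L E)), (hcnt K h : ℤ)) =
      K.card * gs (Fintype.card L) (n + 1) := by exact_mod_cast sum_hcnt_all K (n + 1) hn
  have h2 : (∑ h ∈ pts (⊤ : Submodule L (Dual L E)), (hcnt K h : ℤ) ^ 2) =
      K.card * (Fintype.card L ^ n + K.card * gs (Fintype.card L) n) := by
    exact_mod_cast sum_hcnt_sq K n hn
  have h0 := card_hyps_all (L := L) (E := E) (n + 1) hn
  have h3 : ∀ h : ℙ L (Dual L E), ev K h ^ 2 = (Fintype.card L : ℤ) ^ 2 * (hcnt K h : ℤ) ^ 2 -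
      2 * Fintype.card L * (K.card - 1) * hcnt K h + (K.card - 1 : ℤ) ^ 2 := by
    intro h
    rw [ev]
    ring
  simp only [h3, Finset.sum_add_distrib, Finset.sum_sub_distrib, ← Finset.mul_sum, h1, h2,
    Finset.sum_const, h0, nsmul_eq_mul]
  linear_combination ((Fintype.card L * K.card : ℤ) ^ 2) * gs_int (Fintype.card L) n -
    (2 * Fintype.card L * (K.card - 1) * K.card : ℤ) * gs_int (Fintype.card L) (n + 1) +
    (K.card - 1 : ℤ) ^ 2 * gs_int (Fintype.card L) (n + 1 + 1)

theorem sum_three_values {ι : Type*} (S : Finset ι) (u : ι → ℕ) {a b c : ℕ} (hab : a ≠ b)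
    (hac : a ≠ c) (hbc : b ≠ c) (hu : ∀ i ∈ S, u i = a ∨ u i = b ∨ u i = c) (f : ℕ → ℤ) :
    ∑ i ∈ S, f (u i) = (S.filter fun i => u i = a).card * f a +
      (S.filter fun i => u i = b).card * f b + (S.filter fun i => u i = c).card * f c := by
  have h1 : ∀ i ∈ S, f (u i) = (if u i = a then f a else 0) + (if u i = b then f b else 0) +
      (if u i = c then f c else 0) := by
    intro i hi
    rcases hu i hi with h | h | h <;> simp [h, hab, hac, hbc, hab.symm, hac.symm, hbc.symm]
  rw [Finset.sum_congr rfl h1, Finset.sum_add_distrib, Finset.sum_add_distrib]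
  simp only [← Finset.sum_filter, Finset.sum_const, nsmul_eq_mul]

end Spectrum

section Numerics

theorem quadratic_gap {s M Q₁ d : ℤ} (hs : 2 ≤ s)
    (h : (Q₁ = 1 ∧ 4 ≤ s ∧ s ^ 3 ≤ M) ∨ (s ^ 2 ≤ Q₁ ∧ s ≤ M))
    (hlow : (Q₁ = 1 ∧ 2 * s ≤ d) ∨ (s ^ 2 ≤ Q₁ ∧ s * Q₁ ≤ d))
    (hup : d ≤ s ^ 3 * Q₁ * (s * M - 1) - s ^ 2 - s ^ 4) :
    s ^ 5 * M * Q₁ + (s ^ 2 + 1) * d < d * (s ^ 3 * Q₁ * (s * M - 1) - d) := by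
  set E := s ^ 3 * Q₁ * (s * M - 1) with hE
  -- it suffices to bound the concave function `d * (E - d - q - 1)` at both ends
  have hs4 : 2 * s < s ^ 4 - 1 := by nlinarith [pow_le_pow_left₀ (by norm_num) hs 3]
  obtain ⟨l, hl0, hld, hl⟩ : ∃ l, 0 ≤ l ∧ l ≤ d ∧ s ^ 5 * M * Q₁ < l * (E - l - s ^ 2 - 1) := by
    rcases hlow with ⟨h1, h2⟩ | ⟨h1, h2⟩
    · refine ⟨2 * s, by omega, h2, ?_⟩
      have hM : 8 ≤ M := by
        rcases h with ⟨-, h4, h⟩ | ⟨h, -⟩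
        · nlinarith [pow_le_pow_left₀ (by norm_num) h4 3]
        · nlinarith
      rw [hE, h1]
      have h3 : 8 * s ^ 5 ≤ M * s ^ 5 := by gcongr
      have h4 : 2 * s ^ 4 ≤ s ^ 5 := by
        have : 0 ≤ s ^ 4 * (s - 2) := mul_nonneg (by positivity) (by omega)
        linarith
      have h5 : 2 * s ^ 3 ≤ s ^ 4 := by
        have : 0 ≤ s ^ 3 * (s - 2) := mul_nonneg (by positivity) (by omega)
        linarith
      have h6 : 2 * s ^ 2 ≤ s ^ 3 := by
        have : 0 ≤ s ^ 2 * (s - 2) := mul_nonneg (by positivity) (by omega)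
        linarith
      have h7 : 2 * s ≤ s ^ 2 := by nlinarith
      nlinarith
    · refine ⟨s * Q₁, by nlinarith, h2, ?_⟩
      have hM : s ≤ M := by
        rcases h with ⟨-, h4, h⟩ | ⟨-, h⟩
        · nlinarith [pow_le_pow_left₀ (by norm_num) h4 2]
        · exact h
      have h3 : s ^ 4 * M < E - s * Q₁ - s ^ 2 - 1 := by
        have h4 : s ^ 5 ≤ s ^ 4 * M := by
          have := mul_le_mul_of_nonneg_left hM (show (0 : ℤ) ≤ s ^ 4 by positivity)
          linarith
        have h6 : 0 ≤ s ^ 4 * M - s ^ 3 - s := by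
          nlinarith [pow_le_pow_left₀ (by norm_num) hs 3, pow_le_pow_left₀ (by norm_num) hs 2]
        have h7 := mul_le_mul_of_nonneg_right h1 h6
        have h8 : 4 * (s ^ 4 * M) ≤ s ^ 2 * (s ^ 4 * M) := by
          have : (4 : ℤ) ≤ s ^ 2 := by nlinarith
          have h9 : 0 ≤ s ^ 4 * M := by nlinarith [show (0 : ℤ) ≤ s ^ 5 by positivity]
          exact mul_le_mul_of_nonneg_right this h9
        have h9 : s ^ 3 + s ^ 2 + 1 < 2 * s ^ 5 := by
          have h10 : 4 * s ^ 3 ≤ s ^ 2 * s ^ 3 := by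
            have : (4 : ℤ) ≤ s ^ 2 := by nlinarith
            exact mul_le_mul_of_nonneg_right this (by positivity)
          nlinarith [pow_le_pow_left₀ (by norm_num) hs 2]
        rw [hE]
        nlinarith
      have h4 : 0 < s * Q₁ := by nlinarith
      nlinarith [mul_lt_mul_of_pos_left h3 h4]
  have hu : s ^ 5 * M * Q₁ < (E - s ^ 2 - s ^ 4) * (s ^ 4 - 1) := by
    have hQM : 8 ≤ Q₁ * M ∧ 4 ≤ s * M ∧ 0 < Q₁ := by
      rcases h with ⟨h1, h4, h⟩ | ⟨h1, h⟩
      · have := pow_le_pow_left₀ (by norm_num) h4 3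
        refine ⟨by rw [h1]; linarith, by nlinarith, by omega⟩
      · have : 4 ≤ s ^ 2 := by nlinarith
        refine ⟨by nlinarith, by nlinarith, by omega⟩
    obtain ⟨h1, h2, h3⟩ := hQM
    have h4 : s ^ 4 * (Q₁ * M) ≤ 2 * (E - s ^ 2 - s ^ 4) := by
      have h5 : 0 ≤ s ^ 3 * Q₁ * (s * M - 4) := mul_nonneg (by positivity) (by omega)
      have h6 : 0 ≤ s ^ 4 * (Q₁ * M - 8) := mul_nonneg (by positivity) (by omega)
      have h7 : 4 * s ^ 2 ≤ s ^ 4 := by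
        have : 0 ≤ s ^ 2 * (s ^ 2 - 4) := mul_nonneg (by positivity) (by nlinarith)
        linarith
      rw [hE]
      linarith
    have h5 : 0 < s ^ 4 * (Q₁ * M) := mul_pos (by positivity) (by omega)
    have h6 := mul_le_mul_of_nonneg_right h4 (show 0 ≤ s ^ 4 - 1 by omega)
    have h7 := mul_lt_mul_of_pos_left hs4 h5
    linarith
  have hgoal : s ^ 5 * M * Q₁ < d * (E - d - s ^ 2 - 1) := by
    by_contra! hc
    rcases hup.eq_or_lt with h1 | h1
    · rw [h1] at hc
      linarith
    · have h2 := mul_pos (sub_pos.2 h1) (sub_pos.2 hl)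
      have h3 := mul_nonneg (sub_nonneg.2 hld) (sub_pos.2 hu).le
      have h4 := mul_nonneg (mul_nonneg (sub_nonneg.2 hld) (sub_pos.2 h1).le)
        (show 0 ≤ E - s ^ 2 - s ^ 4 - l by linarith)
      have h5 := mul_nonneg (show 0 ≤ E - s ^ 2 - s ^ 4 - l by linarith) (sub_nonneg.2 hc)
      linarith
  linarith

theorem excess_eq_zero {s M Q₁ d ta tb tc : ℤ} (hs : 2 ≤ s)
    (h : (Q₁ = 1 ∧ 4 ≤ s ∧ s ^ 3 ≤ M) ∨ (s ^ 2 ≤ Q₁ ∧ s ≤ M))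
    (hd0 : 0 ≤ d) (hta : 0 ≤ ta)
    (hup : d ≤ s ^ 3 * Q₁ * (s * M - 1) - s ^ 2 - s ^ 4)
    (h0 : (s ^ 2 - 1) * (ta + tb + tc) = s ^ 6 * M ^ 2 * Q₁ - 1)
    (h1 : (s ^ 2 - 1) * (ta * (-(s ^ 3 * Q₁) - d) + tb * (-d) +
        tc * (s ^ 3 * Q₁ * (s * M - 1) - d)) =
      s ^ 6 * M ^ 2 * Q₁ - (s ^ 2 * Q₁ * (s ^ 2 * (s + 1) * M - s) + (s ^ 2 - 1) * d))
    (h2 : (s ^ 2 - 1) * (ta * (-(s ^ 3 * Q₁) - d) ^ 2 + tb * (-d) ^ 2 +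
        tc * (s ^ 3 * Q₁ * (s * M - 1) - d) ^ 2) =
      (s ^ 2 * Q₁ * (s ^ 2 * (s + 1) * M - s) + (s ^ 2 - 1) * d) *
      (s ^ 6 * M ^ 2 * Q₁ - (s ^ 2 * Q₁ * (s ^ 2 * (s + 1) * M - s) + (s ^ 2 - 1) * d))) :
    d = 0 := by
  have hs2 : 0 ≤ s ^ 2 - 1 := sub_nonneg.2 (one_le_pow₀ (by omega))
  have hM : 2 ≤ M := by
    rcases h with ⟨-, h4, h⟩ | ⟨-, h⟩
    · nlinarith [pow_le_pow_left₀ (by norm_num) h4 3]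
    · omega
  have hQ1 : 1 ≤ Q₁ := by
    rcases h with ⟨h, -⟩ | ⟨h, -⟩
    · omega
    · nlinarith
  have hdvd : s * Q₁ ∣ d := by
    have h3 : s ^ 2 * (s * Q₁ * ((s ^ 2 - 1) * (-ta + tc * (s * M - 1)))) =
      s ^ 2 * (s * Q₁ * ((s * M - 1) * (s ^ 2 * M - 1) + d * (s ^ 3 * M ^ 2)) - d) := by
      linear_combination h1 + d * h0
    have h4 := mul_left_cancel₀ (by positivity) h3
    have h5 : d = s * Q₁ * ((s * M - 1) * (s ^ 2 * M - 1) + d * (s ^ 3 * M ^ 2)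
      - ((s ^ 2 - 1) * (-ta + tc * (s * M - 1)))) := by linear_combination h4
    exact ⟨_, h5⟩
  by_contra hne
  obtain ⟨δ, hδ⟩ := hdvd
  have hδ1 : 1 ≤ δ := by
    have : 0 < s * Q₁ * δ := by rw [← hδ]; omega
    have h3 : 0 < s * Q₁ := by positivity
    exact (pos_iff_pos_of_mul_pos this).1 h3
  have key : (s ^ 2 - 1) * (s ^ 7 * M * Q₁ ^ 2) * ta =
      (s ^ 6 * M ^ 2 * Q₁ - (s ^ 2 * Q₁ * (s ^ 2 * (s + 1) * M - s) + (s ^ 2 - 1) * d)) *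
        (s ^ 5 * M * Q₁ + (s ^ 2 + 1) * d) -
      d * (s ^ 3 * Q₁ * (s * M - 1) - d) * (s ^ 6 * M ^ 2 * Q₁ - 1) := by
    linear_combination h2 + (2 * d - s ^ 3 * Q₁ * (s * M - 1)) * h1 +
      d * (d - s ^ 3 * Q₁ * (s * M - 1)) * h0
  by_cases hδ2 : Q₁ = 1 ∧ δ = 1
  · obtain ⟨hQ, hδ'⟩ := hδ2
    have hd : d = s := by rw [hδ, hQ, hδ']; ring
    rw [hQ] at h0
    rw [hQ, hd] at key h1
    have hta' : (s - 1) * ta = M - 1 := by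
      have : (s ^ 7 * M * (s + 1)) * ((s - 1) * ta) = (s ^ 7 * M * (s + 1)) * (M - 1) := by
        linear_combination key
      exact mul_left_cancel₀ (by positivity) this
    have h3 : (s - 1) * (s * M - 1) * tc = s * M * (s ^ 2 * M - 1) + M - 1 := by
      have : (s ^ 3 * (s + 1)) * ((s - 1) * (-ta + (s * M - 1) * tc)) =
          (s ^ 3 * (s + 1)) * (s * M * (s ^ 2 * M - 1)) := by
        linear_combination h1 + s * h0
      have := mul_left_cancel₀ (by positivity) this
      linear_combination this + hta'
    have h4 : s * M - 1 ∣ s + M - 2 := by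
      refine ⟨(s - 1) * tc - s ^ 2 * M - s + 1, ?_⟩
      linear_combination -h3
    have h5 := Int.le_of_dvd (by omega) h4
    nlinarith
  · have hgap := quadratic_gap hs h (by
      rcases h with ⟨hQ, h⟩ | ⟨hQ, h⟩
      · left
        refine ⟨hQ, ?_⟩
        have : δ ≠ 1 := fun h => hδ2 ⟨hQ, h⟩
        have : 2 ≤ δ := by omega
        rw [hδ, hQ]
        nlinarith
      · right
        refine ⟨hQ, ?_⟩
        rw [hδ]
        exact le_mul_of_one_le_right (by positivity) hδ1) hup
    have h3 : 0 < s ^ 6 * M ^ 2 * Q₁ - 1 := by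
      have : 2 ^ 6 * 2 ^ 2 * 1 ≤ s ^ 6 * M ^ 2 * Q₁ := by gcongr
      linarith
    have h4 : s ^ 6 * M ^ 2 * Q₁ - (s ^ 2 * Q₁ * (s ^ 2 * (s + 1) * M - s) + (s ^ 2 - 1) * d) ≤
        s ^ 6 * M ^ 2 * Q₁ - 1 := by
      have h6 : 1 ≤ s ^ 2 * (s + 1) * M - s := by
        have h8 : 2 * (2 + 1) * 2 ≤ s * (s + 1) * M := by gcongr
        have h9 : 0 ≤ s * (s * (s + 1) * M - 12) := mul_nonneg (by omega) (by linarith)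
        linarith
      have h7 : 0 ≤ (s ^ 2 - 1) * d := mul_nonneg hs2 hd0
      have h8 : 1 ≤ s ^ 2 * Q₁ * (s ^ 2 * (s + 1) * M - s) :=
        Int.add_one_le_iff.2 (mul_pos (by positivity) (by omega))
      linarith
    have h5 : 0 ≤ s ^ 5 * M * Q₁ + (s ^ 2 + 1) * d := by positivity
    have h6 := mul_le_mul_of_nonneg_right h4 h5
    have h7 := mul_lt_mul_of_pos_left hgap h3
    have h8 : 0 ≤ (s ^ 2 - 1) * (s ^ 7 * M * Q₁ ^ 2) * ta :=
      mul_nonneg (mul_nonneg hs2 (by positivity)) hta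
    linarith

end Numerics

section NumericsExact

theorem card_extremal {s M Q₁ ta tc : ℤ} (hs : 2 ≤ s) (hM : 1 ≤ M) (hQ : 1 ≤ Q₁)
    (h1 : (s ^ 2 - 1) * (ta * (-(s ^ 3 * Q₁)) + tc * (s ^ 3 * Q₁ * (s * M - 1))) =
      s ^ 6 * M ^ 2 * Q₁ - (s ^ 2 * Q₁ * (s ^ 2 * (s + 1) * M - s)))
    (h2 : (s ^ 2 - 1) * (ta * (-(s ^ 3 * Q₁)) ^ 2 + tc * (s ^ 3 * Q₁ * (s * M - 1)) ^ 2) =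
      (s ^ 2 * Q₁ * (s ^ 2 * (s + 1) * M - s)) *
      (s ^ 6 * M ^ 2 * Q₁ - (s ^ 2 * Q₁ * (s ^ 2 * (s + 1) * M - s)))) :
    (s ^ 2 - 1) * (ta + tc) = s ^ 4 * M ^ 2 - 1 := by
  have hsM : 0 < s * M - 1 := by nlinarith
  have h3 : (s ^ 2 - 1) * (-ta + (s * M - 1) * tc) = (s * M - 1) * (s ^ 2 * M - 1) := by
    apply mul_left_cancel₀ (show s ^ 3 * Q₁ ≠ 0 by positivity)
    linear_combination h1
  have h4 : (s ^ 2 - 1) * (ta + (s * M - 1) ^ 2 * tc) =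
      (s * (s + 1) * M - 1) * ((s * M - 1) * (s ^ 2 * M - 1)) := by
    apply mul_left_cancel₀ (show s ^ 6 * Q₁ ^ 2 ≠ 0 by positivity)
    linear_combination h2
  have h5 : (s ^ 2 - 1) * tc = (s ^ 2 * M - 1) * (s + 1) := by
    apply mul_left_cancel₀ (show (s * M - 1) * (s * M) ≠ 0 by positivity)
    linear_combination h3 + h4
  linear_combination (s * M) * h5 - h3

theorem no_vertex_contradiction {s M d ta tb tc : ℤ} (hs : 4 ≤ s) (hM : s ^ 3 ≤ M)
    (hd0 : 0 ≤ d) (hta : 0 < ta) (htb : 0 < tb) (htc : 0 < tc)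
    (hY : (s ^ 2 * (s + 1) * M - s) + (s ^ 2 - 1) * d ≤ s ^ 4 * M ^ 2)
    (h0 : (s ^ 2 - 1) * (ta + tb + tc) = s ^ 4 * M ^ 2 - 1)
    (h1 : (s ^ 2 - 1) * (ta * (-s - d) + tb * (s ^ 2 * (s + 1) * M - s - d) +
        tc * (s ^ 2 * M - s - d)) =
      s ^ 4 * M ^ 2 - ((s ^ 2 * (s + 1) * M - s) + (s ^ 2 - 1) * d))
    (h2 : (s ^ 2 - 1) * (ta * (-s - d) ^ 2 + tb * (s ^ 2 * (s + 1) * M - s - d) ^ 2 +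
        tc * (s ^ 2 * M - s - d) ^ 2) =
      ((s ^ 2 * (s + 1) * M - s) + (s ^ 2 - 1) * d) *
      (s ^ 4 * M ^ 2 - ((s ^ 2 * (s + 1) * M - s) + (s ^ 2 - 1) * d))) : False := by
  have hs16 : 4 ^ 2 ≤ s ^ 2 := pow_le_pow_left₀ (by norm_num) hs 2
  have hs2 : 0 < s ^ 2 - 1 := by omega
  have hs3 : 4 ^ 3 ≤ s ^ 3 := pow_le_pow_left₀ (by norm_num) hs 3
  have hM0 : 0 < M := by omega
  have hMbig : (s + 1) ^ 2 + 1 ≤ M := by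
    have h3 : 0 ≤ s ^ 2 * (s - 4) := mul_nonneg (by positivity) (by omega)
    have h4 : 0 ≤ s * (s - 4) := mul_nonneg (by omega) (by omega)
    linarith
  have h1M2 : 1 ≤ M ^ 2 := one_le_pow₀ hM0
  have h1s2M : 1 ≤ s ^ 2 * M := one_le_mul_of_one_le_of_one_le (by omega) hM0
  have hY1 : 0 < s ^ 4 * M ^ 2 - 1 := by
    have h3 : (4 ^ 2) ^ 2 ≤ (s ^ 2) ^ 2 := pow_le_pow_left₀ (by norm_num) hs16 2
    have h4 := mul_le_mul_of_nonneg_right h3 (show 0 ≤ M ^ 2 by positivity)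
    linarith
  have h8a : s + s ^ 2 < (s ^ 2 - 1) * M := by
    have h3 := mul_le_mul_of_nonneg_left hMbig hs2.le
    nlinarith
  have h8b : s + s ^ 2 < (s ^ 3 - 1) * M := by
    have h3 : 0 ≤ s ^ 2 * (s - 1) * M := mul_nonneg (mul_nonneg (by positivity) (by omega)) hM0.le
    linarith
  have hdvd : M ∣ d := by
    have h3 : s ^ 2 * ((s ^ 2 - 1) * (M * tc + (1 + s) * M * tb)) =
        s ^ 2 * ((1 + s + d) * s ^ 2 * M ^ 2 - (s + 1) * M - d) := by
      linear_combination h1 + (s + d) * h0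
    have h4 := mul_left_cancel₀ (by positivity) h3
    have h5 : d = M * ((1 + s + d) * s ^ 2 * M - (s + 1) -
        (s ^ 2 - 1) * (tc + (1 + s) * tb)) := by linear_combination h4
    exact ⟨_, h5⟩
  have keyb : (s ^ 2 - 1) * (s ^ 2 * (s + 1) * M) * (s ^ 3 * M) * tb =
      (s ^ 4 * M ^ 2 - ((s ^ 2 * (s + 1) * M - s) + (s ^ 2 - 1) * d)) *
        (s ^ 3 * M + s + (s ^ 2 + 1) * d) -
      (s + d) * (s ^ 2 * M - s - d) * (s ^ 4 * M ^ 2 - 1) := by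
    linear_combination h2 + (2 * d + s - (s ^ 2 * M - s)) * h1 -
      (s + d) * (s ^ 2 * M - s - d) * h0
  have keya : (s ^ 2 - 1) * (s ^ 2 * (s + 1) * M) * (s ^ 2 * M) * ta =
      (s ^ 4 * M ^ 2 - ((s ^ 2 * (s + 1) * M - s) + (s ^ 2 - 1) * d)) *
        ((s ^ 2 + 1) * d - (s ^ 2 * M - s)) -
      (s ^ 2 * (s + 1) * M - s - d) * (d - (s ^ 2 * M - s)) * (s ^ 4 * M ^ 2 - 1) := by
    linear_combination h2 - ((s ^ 2 * (s + 1) * M - s - d) + (s ^ 2 * M - s - d)) * h1 +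
      (s ^ 2 * (s + 1) * M - s - d) * (s ^ 2 * M - s - d) * h0
  have hposb : 0 < (s ^ 2 - 1) * (s ^ 2 * (s + 1) * M) * (s ^ 3 * M) * tb := by positivity
  have hposa : 0 < (s ^ 2 - 1) * (s ^ 2 * (s + 1) * M) * (s ^ 2 * M) * ta := by positivity
  have hκ : s ^ 4 * M ^ 2 - ((s ^ 2 * (s + 1) * M - s) + (s ^ 2 - 1) * d) ≤
      s ^ 4 * M ^ 2 - 1 := by
    have h3 := mul_le_mul_of_nonneg_right h1s2M (show 0 ≤ s + 1 by omega)
    have h4 : 0 ≤ (s ^ 2 - 1) * d := by positivity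
    linarith
  obtain ⟨δ, rfl⟩ := hdvd
  have hδ0 : 0 ≤ δ := nonneg_of_mul_nonneg_right hd0 hM0
  have hMM : (s + 1) ^ 2 * M + M ≤ M ^ 2 := by
    have := mul_le_mul_of_nonneg_right hMbig hM0.le
    linarith
  rcases hδ0.eq_or_lt with rfl | hδ1
  · refine absurd hposb (not_lt.2 (le_of_eq ?_))
    rw [keyb]
    ring
  rcases lt_trichotomy δ (s ^ 2) with h | rfl | h
  · have h3 : s ^ 2 - 1 ≤ δ * (s ^ 2 - δ) := by
      have := mul_nonneg (show 0 ≤ δ - 1 by omega) (show 0 ≤ s ^ 2 - δ - 1 by omega)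
      linarith
    have h4 : s ^ 3 * M + s + (s ^ 2 + 1) * (M * δ) <
        (s + M * δ) * (s ^ 2 * M - s - M * δ) := by
      have h5 := mul_le_mul_of_nonneg_right h3 (sq_nonneg M)
      have h6 := mul_le_mul_of_nonneg_left hMM hs2.le
      have h7 := mul_nonneg (mul_nonneg (show 0 ≤ s ^ 2 - 1 - δ by omega) (sq_nonneg (s + 1)))
        hM0.le
      linarith
    have h5 : 0 ≤ s ^ 3 * M + s + (s ^ 2 + 1) * (M * δ) := by positivity
    have h6 := mul_le_mul_of_nonneg_right hκ h5
    have h7 := mul_lt_mul_of_pos_right h4 hY1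
    linarith
  · have h3 : 0 < s ^ 5 * M ^ 2 * (s ^ 2 * (s - 1) + 2 * s ^ 2 - s - 1) := by
      apply mul_pos (by positivity)
      have : 0 < s - 1 := by omega
      have : 0 ≤ s ^ 2 * (s - 1) := by positivity
      nlinarith
    have h4 : (s ^ 2 - 1) * (s ^ 2 * (s + 1) * M) * (s ^ 2 * M) * ta =
      -(s ^ 5 * M ^ 2 * (s ^ 2 * (s - 1) + 2 * s ^ 2 - s - 1)) := by
      rw [keya]
      ring
    linarith
  · have hd1 : M * δ < s ^ 2 * (s + 1) * M - s := by
      by_contra! hc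
      have h3 : ta * (-s - M * δ) < 0 := mul_neg_of_pos_of_neg hta (by linarith)
      have h4 : tb * (s ^ 2 * (s + 1) * M - s - M * δ) ≤ 0 :=
        mul_nonpos_of_nonneg_of_nonpos htb.le (by linarith)
      have h5 : tc * (s ^ 2 * M - s - M * δ) ≤ 0 := by
        apply mul_nonpos_of_nonneg_of_nonpos htc.le
        have : 0 ≤ s ^ 3 * M := by positivity
        linarith
      have h6 := mul_neg_of_pos_of_neg hs2 (show ta * (-s - M * δ) +
        tb * (s ^ 2 * (s + 1) * M - s - M * δ) + tc * (s ^ 2 * M - s - M * δ) < 0 by linarith)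
      linarith
    obtain ⟨η, rfl⟩ : ∃ η, δ = s ^ 2 + η := ⟨δ - s ^ 2, by ring⟩
    have hη : η < s ^ 3 := by
      have : M * η < M * s ^ 3 := by linarith
      exact lt_of_mul_lt_mul_left this hM0.le
    have h3 : s ^ 3 - 1 ≤ η * (s ^ 3 - η) := by
      have := mul_nonneg (show 0 ≤ η - 1 by omega) (show 0 ≤ s ^ 3 - η - 1 by omega)
      linarith
    have h4 : (s ^ 2 + 1) * (M * (s ^ 2 + η)) - (s ^ 2 * M - s) <
        (s ^ 2 * (s + 1) * M - s - M * (s ^ 2 + η)) * (M * (s ^ 2 + η) - (s ^ 2 * M - s)) := by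
      have h5 := mul_le_mul_of_nonneg_right h3 (sq_nonneg M)
      have h6 := mul_le_mul_of_nonneg_left hMM (show 0 ≤ s ^ 3 - 1 by omega)
      have h7 := mul_nonneg (mul_nonneg (show 0 ≤ s ^ 3 - 1 - η by omega) (sq_nonneg (s + 1)))
        hM0.le
      linarith
    have h5 : 0 ≤ (s ^ 2 + 1) * (M * (s ^ 2 + η)) - (s ^ 2 * M - s) := by
      have h6 : 0 ≤ η := by omega
      have : 0 ≤ s ^ 2 * (M * (s ^ 2 + η)) := by positivity
      have : 0 ≤ M * η := by positivity
      linarith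
    have h6 := mul_le_mul_of_nonneg_right hκ h5
    have h7 := mul_lt_mul_of_pos_right h4 hY1
    linarith

end NumericsExact

section Extremal

set_option linter.unusedSectionVars false

open scoped LinearAlgebra.Projectivization

variable {L : Type*} [Field L] [Fintype L] {E : Type*} [AddCommGroup E] [Module L E]
  [FiniteDimensional L E]

/-- The hyperplanes meeting `K` in exactly `x` points. -/
def hypsWith (K : Finset (ℙ L E)) (x : ℕ) : Finset (ℙ L (Dual L E)) :=
  (pts (⊤ : Submodule L (Dual L E))).filter fun h => hcnt K h = x

theorem mem_hypsWith {K : Finset (ℙ L E)} {x : ℕ} {h : ℙ L (Dual L E)} :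
    h ∈ hypsWith K x ↔ hcnt K h = x := by
  simp [hypsWith]

/-- The zeroth, first and second moment of the intersection numbers with hyperplanes. -/
theorem three_value_moments (K : Finset (ℙ L E)) (n : ℕ) (hn : finrank L E = n + 2) {a b c : ℕ}
    (hab : a ≠ b) (hac : a ≠ c) (hbc : b ≠ c)
    (hK : ∀ h, hcnt K h = a ∨ hcnt K h = b ∨ hcnt K h = c) {q ea eb ec κ : ℤ}
    (hq : (Fintype.card L : ℤ) = q) (hea : q * a - K.card + 1 = ea)
    (heb : q * b - K.card + 1 = eb) (hec : q * c - K.card + 1 = ec)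
    (hκ : (q - 1) * K.card + 1 = κ) :
    (q - 1) * ((hypsWith K a).card + (hypsWith K b).card + (hypsWith K c).card) =
      q ^ (n + 2) - 1 ∧
    (q - 1) * ((hypsWith K a).card * ea + (hypsWith K b).card * eb + (hypsWith K c).card * ec) =
      q ^ (n + 2) - κ ∧
    (q - 1) * ((hypsWith K a).card * ea ^ 2 + (hypsWith K b).card * eb ^ 2 +
      (hypsWith K c).card * ec ^ 2) = κ * (q ^ (n + 2) - κ) := by
  subst hq hea heb hec hκ
  have key := sum_three_values (pts (⊤ : Submodule L (Dual L E))) (hcnt K) hab hac hbc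
    (fun h _ => hK h)
  refine ⟨?_, ?_, ?_⟩
  · have h1 := key fun _ => 1
    have h2 := gs_int (Fintype.card L) (n + 2)
    rw [← card_hyps_all (E := E) (n + 1) hn] at h2
    simp only [Finset.sum_const, mul_one, nsmul_eq_mul] at h1
    rw [← h2, h1]
    rfl
  · have h1 := key fun x => (Fintype.card L : ℤ) * x - K.card + 1
    exact h1 ▸ sum_ev K (n + 1) hn
  · have h1 := key fun x => ((Fintype.card L : ℤ) * x - K.card + 1) ^ 2
    exact h1 ▸ sum_ev_sq K n hn

theorem gs_double (s t : ℕ) : gs s (2 * t) = (1 + s) * gs (s ^ 2) t := by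
  induction t with
  | zero => simp [gs_zero]
  | succ t ih => rw [mul_add, mul_one, gs_succ, gs_succ, ih, gs_succ]; ring

/-- A blocking set having a hyperplane with as many points as a Baer cone is as large as the
cone. -/
theorem card_ge_cone (K : Finset (ℙ L E)) {s t m : ℕ} (hs : 2 ≤ s) (hq : Fintype.card L = s ^ 2)
    (hn : finrank L E = 2 * t + m + 1)
    (hblock : ∀ W : Submodule L E, finrank L W = t + 1 → 0 < cnt K W)
    (hc : ∃ h, hcnt K h = gs s (2 * t) * (s ^ 2) ^ m + gs (s ^ 2) m) :
    gs s (2 * t + 1) * (s ^ 2) ^ m + gs (s ^ 2) m ≤ K.card := by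
  obtain ⟨h, hh⟩ := hc
  have h1 := finrank_hyp h
  have h2 := card_ge_of_blocking K (2 * t + m) t hn (by omega) hblock
    h.submodule.dualCoannihilator (by omega) (by
      rw [← hcnt, hh, hq, show 2 * t + m + 1 - t = m + (t + 1) by omega, gs_add, gs_double,
        gs_succ', add_comm]
      have h3 : (1 + s) * gs (s ^ 2) t < s ^ 2 * gs (s ^ 2) t + 1 := by
        have : 1 + s ≤ s ^ 2 := by nlinarith
        have := Nat.mul_le_mul_right (gs (s ^ 2) t) this
        omega
      have h4 : 0 < (s ^ 2) ^ m := by positivity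
      have := Nat.mul_lt_mul_of_pos_left h3 h4
      linarith)
  rw [← hcnt, hh, hq, show 2 * t + m - t = t + m by omega] at h2
  rw [gs_succ]
  calc _ = gs s (2 * t) * (s ^ 2) ^ m + gs (s ^ 2) m + (s ^ 2) ^ (t + m) := by ring
    _ ≤ _ := h2

/-- The number of points of a cone over a Baer subgeometry of rank `2 * t + 3` with a vertex of
rank `m + 1`, and the numbers of points in its hyperplanes. -/
theorem cone_numbers (s t m : ℕ) {k a b c : ℕ}
    (hk : k = gs s (2 * t + 3) * (s ^ 2) ^ (m + 1) + gs (s ^ 2) (m + 1))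
    (ha : a = gs s (2 * t + 1) * (s ^ 2) ^ (m + 1) + gs (s ^ 2) (m + 1))
    (hb : b = gs s (2 * t + 3) * (s ^ 2) ^ m + gs (s ^ 2) m)
    (hc : c = gs s (2 * t + 2) * (s ^ 2) ^ (m + 1) + gs (s ^ 2) (m + 1)) :
    (s : ℤ) ^ 2 * a - k + 1 = -(s ^ 3 * (s ^ 2) ^ m) ∧ (s : ℤ) ^ 2 * b - k + 1 = 0 ∧
    (s : ℤ) ^ 2 * c - k + 1 = s ^ 3 * (s ^ 2) ^ m * (s * s ^ (2 * t + 1) - 1) ∧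
    ((s : ℤ) ^ 2 - 1) * k + 1 =
      s ^ 2 * (s ^ 2) ^ m * (s ^ 2 * (s + 1) * s ^ (2 * t + 1) - s) := by
  have h1 := gs_int (s ^ 2) m
  have h2 := gs_int s (2 * t + 1)
  subst hk ha hb hc
  simp only [gs_succ' s (2 * t + 2), gs_succ' s (2 * t + 1), gs_succ (s ^ 2) m]
  push_cast at h1 ⊢
  set x : ℤ := (gs s (2 * t + 1) : ℤ)
  set y : ℤ := (gs (s ^ 2) m : ℤ)
  set Q : ℤ := ((s : ℤ) ^ 2) ^ m
  rw [pow_succ ((s : ℤ) ^ 2) m]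
  refine ⟨?_, ?_, ?_, ?_⟩
  · linear_combination h1
  · linear_combination h1
  · linear_combination h1 + Q * (s : ℤ) ^ 4 * h2
  · linear_combination h1 + Q * (s : ℤ) ^ 4 * (s + 1) * h2

theorem card_eq_cone (K : Finset (ℙ L E)) {s t m k a b c : ℕ} (hs : 2 ≤ s)
    (hq : Fintype.card L = s ^ 2) (hn : finrank L E = 2 * t + m + 4)
    (hcase : (m = 0 ∧ 1 ≤ t ∧ 4 ≤ s) ∨ 1 ≤ m)
    (hk : k = gs s (2 * t + 3) * (s ^ 2) ^ (m + 1) + gs (s ^ 2) (m + 1))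
    (ha : a = gs s (2 * t + 1) * (s ^ 2) ^ (m + 1) + gs (s ^ 2) (m + 1))
    (hb : b = gs s (2 * t + 3) * (s ^ 2) ^ m + gs (s ^ 2) m)
    (hc : c = gs s (2 * t + 2) * (s ^ 2) ^ (m + 1) + gs (s ^ 2) (m + 1))
    (hblock : ∀ W : Submodule L E, finrank L W = t + 2 → 0 < cnt K W)
    (hK : ∀ h, hcnt K h = a ∨ hcnt K h = b ∨ hcnt K h = c)
    (hA : ∃ h, hcnt K h = a) (hB : ∃ h, hcnt K h = b) (hC : ∃ h, hcnt K h = c) :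
    K.card = k ∧ (hypsWith K a).card + (hypsWith K c).card = gs (s ^ 2) (2 * t + 3) ∧
      a ≠ b ∧ b ≠ c := by
  have hs' : (2 : ℤ) ≤ s := by exact_mod_cast hs
  have hs2 : (s : ℤ) + 1 ≤ s ^ 2 - 1 := by nlinarith
  have hss : 0 < (s : ℤ) ^ 2 := by positivity
  obtain ⟨ea, eb, ec, hκ⟩ := cone_numbers s t m hk ha hb hc
  have hkK : k ≤ K.card := by
    subst hk hc
    exact card_ge_cone K (t := t + 1) (m := m + 1) hs hq (by omega) hblock hC
  obtain ⟨d, hd⟩ : ∃ d : ℤ, (K.card : ℤ) = k + d := ⟨K.card - k, by ring⟩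
  have hd0 : 0 ≤ d := by omega
  set M : ℤ := (s : ℤ) ^ (2 * t + 1) with hM
  set Q : ℤ := ((s : ℤ) ^ 2) ^ m with hQ
  have hQ1 : 1 ≤ Q := one_le_pow₀ (by omega)
  have hM1 : s ≤ M := le_self_pow₀ (by omega) (by omega)
  have hsM : 1 < s * M := by nlinarith
  have hs3Q : 0 < (s : ℤ) ^ 3 * Q := by positivity
  have hE : 0 < (s : ℤ) ^ 3 * Q * (s * M - 1) := mul_pos hs3Q (by omega)
  have hab : a < b := by
    have : (s : ℤ) ^ 2 * a < s ^ 2 * b := by omega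
    exact_mod_cast lt_of_mul_lt_mul_left this hss.le
  have hbc : b < c := by
    have : (s : ℤ) ^ 2 * b < s ^ 2 * c := by omega
    exact_mod_cast lt_of_mul_lt_mul_left this hss.le
  have hqs : (Fintype.card L : ℤ) = (s : ℤ) ^ 2 := by rw [hq]; push_cast; rfl
  obtain ⟨h0, h1, h2⟩ := three_value_moments K (2 * t + m + 2) hn hab.ne (hab.trans hbc).ne hbc.ne
    hK hqs (ea := -(s ^ 3 * Q) - d) (eb := -d) (ec := s ^ 3 * Q * (s * M - 1) - d)
    (κ := s ^ 2 * Q * (s ^ 2 * (s + 1) * M - s) + (s ^ 2 - 1) * d)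
    (by linear_combination ea - hd) (by linear_combination eb - hd) (by linear_combination ec - hd)
    (by linear_combination hκ + ((s : ℤ) ^ 2 - 1) * hd)
  have hY : ((s : ℤ) ^ 2) ^ (2 * t + m + 2 + 2) = s ^ 6 * M ^ 2 * Q := by
    rw [hM, hQ]; ring
  rw [hY] at h0 h1 h2
  have hcase' : (Q = 1 ∧ 4 ≤ (s : ℤ) ∧ (s : ℤ) ^ 3 ≤ M) ∨ ((s : ℤ) ^ 2 ≤ Q ∧ s ≤ M) := by
    rcases hcase with ⟨rfl, ht, h4⟩ | hm
    · exact Or.inl ⟨by simp [hQ], by exact_mod_cast h4,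
        pow_le_pow_right₀ (by omega) (by omega)⟩
    · exact Or.inr ⟨le_self_pow₀ (by omega) (by omega), hM1⟩
  have hup : d ≤ s ^ 3 * Q * (s * M - 1) - s ^ 2 - s ^ 4 := by
    obtain ⟨A, hA⟩ := hA
    obtain ⟨B, hB⟩ := hB
    obtain ⟨U, hU, hUle⟩ := pencil_bound K (A := A) (B := B)
      (by rintro rfl; exact hab.ne (hA ▸ hB)) c (fun h => by have := hK h; omega)
    have hu := cnt_ge_of_blocking K (t + 1) hblock U (by omega)
    have hu2 : gs (s ^ 2) 2 ≤ cnt K U := by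
      rw [← hq]
      exact (gs_mono _ (by omega)).trans hu
    rw [gs_succ, gs_one, pow_one] at hu2
    rw [hA, hB, hq] at hUle
    zify at hUle hu2
    have hκ2 : (k : ℤ) ≤ s ^ 4 * M * Q := by
      have h3 : ((s : ℤ) ^ 2 - 1) * k ≤ (s ^ 2 - 1) * (s ^ 4 * M * Q) := by
        have h4 : 0 ≤ (s : ℤ) ^ 4 * M * Q * (s ^ 2 - 1 - (s + 1)) :=
          mul_nonneg (by positivity) (by omega)
        have h5 : 0 ≤ (s : ℤ) ^ 3 * Q := hs3Q.le
        linarith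
      exact le_of_mul_le_mul_left h3 (by omega)
    have h5 := mul_le_mul_of_nonneg_left hUle hss.le
    have h6 := mul_le_mul_of_nonneg_left hu2 (show 0 ≤ (s : ℤ) ^ 4 by positivity)
    have h7 : (s : ℤ) ^ 2 * d ≤ s ^ 2 * (s ^ 3 * Q * (s * M - 1) - s ^ 2 - s ^ 4) := by
      linear_combination h5 + h6 + hκ2 + ea + eb + (s ^ 2 - 1) * ec - s ^ 2 * hd + hss
    exact le_of_mul_le_mul_left h7 hss
  obtain rfl := excess_eq_zero hs' hcase' hd0 (by positivity) hup h0 h1 h2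
  refine ⟨by omega, ?_, hab.ne, hbc.ne⟩
  have h3 := card_extremal (M := M) (ta := (hypsWith K a).card)
    (tc := (hypsWith K c).card) hs' (by omega) hQ1 (by linear_combination h1) (by linear_combination h2)
  have h4 := gs_int (s ^ 2) (2 * t + 3)
  have h5 : ((s : ℤ) ^ 2) ^ (2 * t + 3) = s ^ 4 * M ^ 2 := by rw [hM]; ring
  push_cast at h4
  rw [h5, ← h3] at h4
  have h6 := mul_left_cancel₀ (by omega) h4
  exact_mod_cast h6.symm

end Extremal

section Vertex

set_option linter.unusedSectionVars false

open scoped LinearAlgebra.Projectivization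

variable {L : Type*} [Field L] [Fintype L] {E : Type*} [AddCommGroup E] [Module L E]
  [FiniteDimensional L E]

/-- The extremal case in which the vertex would be empty does not occur. -/
theorem not_type_of_no_vertex (K : Finset (ℙ L E)) {s t a b c : ℕ} (hs : 4 ≤ s) (ht : 1 ≤ t)
    (hq : Fintype.card L = s ^ 2) (hn : finrank L E = 2 * t + 3)
    (ha : a = gs s (2 * t + 1)) (hb : b = gs s (2 * t + 3)) (hc : c = gs s (2 * t + 2))
    (hblock : ∀ W : Submodule L E, finrank L W = t + 2 → 0 < cnt K W)
    (hK : ∀ h, hcnt K h = a ∨ hcnt K h = b ∨ hcnt K h = c)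
    (hA : ∃ h, hcnt K h = a) (hB : ∃ h, hcnt K h = b) (hC : ∃ h, hcnt K h = c) : False := by
  have hkK : b ≤ K.card := by
    have := card_ge_cone K (s := s) (t := t + 1) (m := 0) (by omega) hq (by omega) hblock
      (by subst hc; simpa [gs_zero, mul_add] using hC)
    subst hb
    simpa [gs_zero, mul_add] using this
  have hmono := gs_strictMono (show 0 < s by omega)
  have hac : a < c := by subst ha hc; exact hmono (by omega)
  have hcb : c < b := by subst hb hc; exact hmono (by omega)
  have hcard := cnt_le_card_pts K ⊤
  rw [cnt_top, finrank_top, hn, hq] at hcard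
  obtain ⟨d, hd⟩ : ∃ d : ℤ, (K.card : ℤ) = b + d := ⟨K.card - b, by ring⟩
  have hd0 : 0 ≤ d := by omega
  have hs' : (4 : ℤ) ≤ s := by exact_mod_cast hs
  have hss : 0 < (s : ℤ) ^ 2 - 1 := by nlinarith
  have h1 := gs_int s (2 * t + 1)
  have h2 := gs_int (s ^ 2) (2 * t + 3)
  zify at hcard
  have hM3 : (s : ℤ) ^ 3 ≤ s ^ (2 * t + 1) := pow_le_pow_right₀ (by omega) (by omega)
  set M : ℤ := (s : ℤ) ^ (2 * t + 1) with hM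
  have hY : ((s : ℤ) ^ 2) ^ (2 * t + 3) = s ^ 4 * M ^ 2 := by rw [hM]; ring
  push_cast at h2
  rw [hY] at h2
  have hc' : (c : ℤ) = s * gs s (2 * t + 1) + 1 := by subst hc; rw [gs_succ']; push_cast; rfl
  have hb' : (b : ℤ) = s * c + 1 := by subst hb hc; rw [gs_succ' s (2 * t + 2)]; push_cast; rfl
  have hqs : (Fintype.card L : ℤ) = (s : ℤ) ^ 2 := by rw [hq]; push_cast; rfl
  have hcardle := mul_le_mul_of_nonneg_left hcard hss.le
  rw [hd, h2] at hcardle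
  have hbM : ((s : ℤ) ^ 2 - 1) * b + 1 = s ^ 2 * (s + 1) * M - s := by
    rw [hb', hc']; linear_combination (s + 1) * (s : ℤ) ^ 2 * h1
  obtain ⟨e0, e1, e2⟩ := three_value_moments K (2 * t + 1) hn (hac.trans hcb).ne hac.ne hcb.ne'
    hK hqs (ea := -s - d) (eb := s ^ 2 * (s + 1) * M - s - d) (ec := s ^ 2 * M - s - d)
    (κ := (s ^ 2 * (s + 1) * M - s) + (s ^ 2 - 1) * d)
    (by rw [ha]; linear_combination -hd - hb' - (s : ℤ) * hc')
    (by linear_combination hbM - hd)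
    (by linear_combination -hd - hb' + (s ^ 2 - s : ℤ) * hc' + (s : ℤ) ^ 2 * h1)
    (by linear_combination hbM + ((s : ℤ) ^ 2 - 1) * hd)
  rw [show 2 * t + 1 + 2 = 2 * t + 3 from rfl, hY] at e0 e1 e2
  have pos : ∀ x, (∃ h, hcnt K h = x) → (0 : ℤ) < (hypsWith K x).card := by
    rintro x ⟨h, hh⟩
    exact_mod_cast Finset.card_pos.2 ⟨h, mem_hypsWith.2 hh⟩
  exact no_vertex_contradiction hs' hM3 hd0 (pos a hA) (pos b hB) (pos c hC) (by linarith) e0 e1 e2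

/-- In a set with the parameters of a Baer cone, the hyperplanes with an extremal intersection
number are those through a fixed subspace, the future vertex. -/
theorem exists_vertex (K : Finset (ℙ L E)) {s t m k a b c : ℕ} (hs : 2 ≤ s)
    (hq : Fintype.card L = s ^ 2) (hn : finrank L E = 2 * t + m + 4)
    (hk : k = gs s (2 * t + 3) * (s ^ 2) ^ (m + 1) + gs (s ^ 2) (m + 1))
    (hb : b = gs s (2 * t + 3) * (s ^ 2) ^ m + gs (s ^ 2) m)
    (hK : ∀ h, hcnt K h = a ∨ hcnt K h = b ∨ hcnt K h = c) (hab : a ≠ b) (hbc : b ≠ c)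
    (hac : a ≠ c) (hcard : K.card = k)
    (hext : (hypsWith K a).card + (hypsWith K c).card = gs (s ^ 2) (2 * t + 3)) :
    ∃ V : Submodule L E, finrank L V = m + 1 ∧
      ∀ h : ℙ L (Dual L E), V ≤ h.submodule.dualCoannihilator ↔ hcnt K h ≠ b := by
  classical
  obtain ⟨V', hV', hD⟩ := minimal_blocking_eq_pts (hypsWith K a ∪ hypsWith K c) (2 * t + 3)
    (m + 1) (by rw [Subspace.dual_finrank_eq, hn]; ring) (by
      rw [Finset.card_union_of_disjoint, hext, hq]
      rw [Finset.disjoint_left]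
      intro h h1 h2
      rw [mem_hypsWith] at h1 h2
      exact hac (h1.symm.trans h2)) (by
    intro W hW
    by_contra! h0
    rw [Nat.le_zero, cnt_eq_zero] at h0
    have hall : ∀ h ∈ pts W, hcnt K h = b := by
      intro h hh
      by_contra hne
      refine h0 h ?_ (mem_pts.1 hh)
      have := hK h
      simp only [Finset.mem_union, mem_hypsWith]
      tauto
    have hZ := sum_hcnt K W.dualCoannihilator (m + 1) (by
      have := Subspace.finrank_add_finrank_dualCoannihilator_eq W
      omega)
    rw [Subspace.dualCoannihilator_dualAnnihilator_eq, Finset.sum_congr rfl hall,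
      Finset.sum_const, smul_eq_mul, card_pts, hW, hcard, hq, hb, hk] at hZ
    have hy := gs_int (s ^ 2) m
    zify [gs_succ (s ^ 2), gs_succ' s (2 * t + 2), gs_succ' s (2 * t + 1)] at hZ
    push_cast at hy
    have h2 : (cnt K W.dualCoannihilator : ℤ) * s = s * gs s (2 * t + 1) + 1 := by
      have h3 : (s : ℤ) * ((s : ℤ) ^ 2) ^ m ≠ 0 := by positivity
      apply mul_left_cancel₀ h3
      linear_combination -hZ - ((s : ℤ) ^ 2) ^ m * s * (s * gs s (2 * t + 1) + 1) * hy
    have h4 : (s : ℤ) ∣ 1 := ⟨cnt K W.dualCoannihilator - gs s (2 * t + 1), by linarith⟩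
    have := Int.le_of_dvd one_pos h4
    omega)
  refine ⟨V'.dualCoannihilator, ?_, ?_⟩
  · have := Subspace.finrank_add_finrank_dualCoannihilator_eq V'
    omega
  · intro h
    rw [← dual_submodule_le_iff, Subspace.dualCoannihilator_dualAnnihilator_eq, ← mem_pts, ← hD,
      Finset.mem_union, mem_hypsWith, mem_hypsWith]
    have := hK h
    grind

end Vertex

section Cone

set_option linter.unusedSectionVars false

open scoped LinearAlgebra.Projectivization

variable {L : Type*} [Field L] [Fintype L] {E : Type*} [AddCommGroup E] [Module L E]
  [FiniteDimensional L E]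

theorem sum_hcnt_sub_sup (K : Finset (ℙ L E)) (b : ℕ) {V : Submodule L E}
    (hV : ∀ h : ℙ L (Dual L E), ¬ V ≤ h.submodule.dualCoannihilator → hcnt K h = b)
    (Z : Submodule L E) :
    ∑ h ∈ pts Z.dualAnnihilator, ((hcnt K h : ℤ) - b) =
      ∑ h ∈ pts (V ⊔ Z).dualAnnihilator, ((hcnt K h : ℤ) - b) := by
  symm
  apply Finset.sum_subset
  · intro h hh
    rw [mem_pts, dual_submodule_le_iff] at hh ⊢
    exact le_sup_right.trans hh
  · intro h hh hh'
    rw [mem_pts, dual_submodule_le_iff] at hh hh'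
    rw [hV h fun hle => hh' (sup_le hle hh), sub_self]

theorem cnt_eq_one_or_zero (K : Finset (ℙ L E)) [DecidableEq (ℙ L E)] (P : ℙ L E) :
    cnt K P.submodule = if P ∈ K then 1 else 0 := by
  split_ifs with h
  · exact cnt_point h
  · exact cnt_point_not_mem h

/-- Membership of a point depends only on the span of the point and the vertex. -/
theorem mem_iff_of_sup_eq (K : Finset (ℙ L E)) (b j : ℕ) (hj : finrank L E = j + 2)
    {V : Submodule L E}
    (hV : ∀ h : ℙ L (Dual L E), ¬ V ≤ h.submodule.dualCoannihilator → hcnt K h = b)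
    {P Q : ℙ L E} (hPQ : V ⊔ P.submodule = V ⊔ Q.submodule) : P ∈ K ↔ Q ∈ K := by
  classical
  have key : ∀ R : ℙ L E, ∑ h ∈ pts (V ⊔ R.submodule).dualAnnihilator, ((hcnt K h : ℤ) - b) =
      (if R ∈ K then 1 else 0) * (Fintype.card L : ℤ) ^ j + K.card * gs (Fintype.card L) j -
        gs (Fintype.card L) (j + 1) * b := by
    intro R
    have h1 := sum_hcnt K R.submodule j (by rw [R.finrank_submodule, hj]; ring)
    rw [cnt_eq_one_or_zero] at h1
    zify at h1
    rw [← sum_hcnt_sub_sup K b hV, Finset.sum_sub_distrib, h1, Finset.sum_const, card_hyps,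
      R.finrank_submodule, nsmul_eq_mul, show finrank L E - 1 = j + 1 by omega]
  have h1 := (key P).symm.trans ((congrArg (fun Z : Submodule L E =>
    ∑ h ∈ pts Z.dualAnnihilator, ((hcnt K h : ℤ) - b)) hPQ).trans (key Q))
  have h2 : (0 : ℤ) < (Fintype.card L : ℤ) ^ j := by
    have : 0 < Fintype.card L := Fintype.card_pos
    positivity
  by_cases hP : P ∈ K <;> by_cases hQ : Q ∈ K <;> simp [hP, hQ] at h1 ⊢

/-- The vertex is contained in `K`. -/
theorem vertex_subset (K : Finset (ℙ L E)) (b j m : ℕ) (hj : finrank L E = j + m + 2)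
    {V : Submodule L E} (hVm : finrank L V = m + 1)
    (hV : ∀ h : ℙ L (Dual L E), ¬ V ≤ h.submodule.dualCoannihilator → hcnt K h = b)
    (hKb : K.card = Fintype.card L * b + 1) : pts V ⊆ K := by
  classical
  have hq : 0 < Fintype.card L := Fintype.card_pos
  have h1 := sum_hcnt_sub_sup K b hV ⊥
  rw [sup_bot_eq, Finset.sum_sub_distrib, Finset.sum_sub_distrib, Finset.sum_const,
    Finset.sum_const, card_hyps, card_hyps] at h1
  have h2 := sum_hcnt K ⊥ (j + m + 1) (by rw [finrank_bot, hj]; ring)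
  have h3 := sum_hcnt K V j (by rw [hVm, hj]; ring)
  have h4 : cnt K (⊥ : Submodule L E) = 0 := by
    rw [cnt_eq_zero]
    intro P _ hP
    have := P.finrank_submodule
    rw [le_bot_iff.1 hP, finrank_bot] at this
    omega
  zify at h2 h3
  rw [h2, h3, h4, hVm, finrank_bot, show finrank L E - (m + 1) = j + 1 by omega,
    show finrank L E - 0 = (j + 1) + (m + 1) by omega, show j + m + 1 = j + (m + 1) by ring,
    gs_add _ (j + 1), gs_add _ j (m + 1), hKb] at h1
  have h5 : (cnt K V : ℤ) = gs (Fintype.card L) (m + 1) := by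
    have h6 : (Fintype.card L : ℤ) ^ j ≠ 0 := by positivity
    apply mul_left_cancel₀ h6
    simp only [nsmul_eq_mul] at h1
    push_cast at h1
    linear_combination -h1
  norm_cast at h5
  have h6 : (K.filter fun P => P.submodule ≤ V) = pts V := by
    apply Finset.eq_of_subset_of_card_le
    · intro P hP
      exact mem_pts.2 (Finset.mem_filter.1 hP).2
    · rw [card_pts, hVm, ← h5, cnt]
  intro P hP
  rw [← h6] at hP
  exact (Finset.mem_filter.1 hP).1

theorem exists_point_of_le_sup {V Z : Submodule L E} {Q : ℙ L E} (hQ : Q.submodule ≤ V ⊔ Z)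
    (hQV : ¬ Q.submodule ≤ V) :
    ∃ R : ℙ L E, R.submodule ≤ Z ∧ ¬ R.submodule ≤ V ∧ V ⊔ R.submodule = V ⊔ Q.submodule := by
  rw [submodule_le_iff_rep] at hQ
  obtain ⟨v, hv, z, hz, hvz⟩ := Submodule.mem_sup.1 hQ
  have hzV : z ∉ V := by
    intro h
    exact hQV (submodule_le_iff_rep.2 (hvz ▸ V.add_mem hv h))
  have hz0 : z ≠ 0 := fun h => hzV (h ▸ V.zero_mem)
  have hR : ¬ (Projectivization.mk L z hz0).submodule ≤ V := by
    rw [Projectivization.submodule_mk, Submodule.span_singleton_le_iff_mem]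
    exact hzV
  have hle : Q.submodule ≤ V ⊔ (Projectivization.mk L z hz0).submodule := by
    rw [submodule_le_iff_rep, ← hvz, Projectivization.submodule_mk]
    exact Submodule.add_mem_sup hv (Submodule.mem_span_singleton_self z)
  refine ⟨Projectivization.mk L z hz0, ?_, hR,
    le_antisymm (sup_le le_sup_left ?_) (sup_le le_sup_left hle)⟩
  · rwa [Projectivization.submodule_mk, Submodule.span_singleton_le_iff_mem]
  · exact sup_point_exchange hQV hR hle

/-- Counting the points in a span by projecting from one of its two parts to the other. -/
theorem cnt_sup_eq_sum (K : Finset (ℙ L E)) {V Z : Submodule L E} (hVZ : V ⊓ Z = ⊥) :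
    cnt K (V ⊔ Z) = cnt K V + ∑ R ∈ pts Z, (cnt K (V ⊔ R.submodule) - cnt K V) := by
  classical
  have hnot : ∀ R : ℙ L E, R.submodule ≤ Z → ¬ R.submodule ≤ V := by
    intro R h1 h2
    have h3 := le_inf h2 h1
    rw [hVZ] at h3
    have := R.finrank_submodule
    rw [le_bot_iff.1 h3, finrank_bot] at this
    omega
  have h1 : K.filter (fun P => P.submodule ≤ V ⊔ Z) = K.filter (fun P => P.submodule ≤ V) ∪
      (pts Z).biUnion fun R => K.filter (fun P => P.submodule ≤ V ⊔ R.submodule) \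
        K.filter (fun P => P.submodule ≤ V) := by
    ext Q
    simp only [Finset.mem_filter, Finset.mem_union, Finset.mem_biUnion, Finset.mem_sdiff, mem_pts]
    constructor
    · rintro ⟨hQK, hQ⟩
      by_cases hQV : Q.submodule ≤ V
      · exact Or.inl ⟨hQK, hQV⟩
      · obtain ⟨R, hRZ, -, hR⟩ := exists_point_of_le_sup hQ hQV
        exact Or.inr ⟨R, hRZ, ⟨hQK, hR ▸ le_sup_right⟩, fun h => hQV h.2⟩
    · rintro (⟨hQK, hQV⟩ | ⟨R, hRZ, ⟨hQK, hQ⟩, -⟩)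
      · exact ⟨hQK, hQV.trans le_sup_left⟩
      · exact ⟨hQK, hQ.trans (sup_le_sup_left hRZ V)⟩
  rw [cnt, h1, Finset.card_union_of_disjoint, Finset.card_biUnion]
  · congr 1
    refine Finset.sum_congr rfl fun R _ => Finset.card_sdiff_of_subset ?_
    exact Finset.monotone_filter_right _ fun P _ (hP : P.submodule ≤ V) => hP.trans le_sup_left
  · intro R hR R' hR' hne
    rw [Function.onFun, Finset.disjoint_left]
    intro Q hQ hQ'
    simp only [Finset.mem_sdiff, Finset.mem_filter] at hQ hQ'
    have hQV : ¬ Q.submodule ≤ V := fun h => hQ.2 ⟨hQ.1.1, h⟩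
    have h2 := sup_point_exchange hQV (hnot R (mem_pts.1 hR)) hQ.1.2
    have h3 : R.submodule ≤ (V ⊔ R'.submodule) ⊓ Z :=
      le_inf (h2.trans (sup_le le_sup_left hQ'.1.2)) (mem_pts.1 hR)
    rw [sup_comm, sup_inf_assoc_of_le _ (mem_pts.1 hR'), hVZ, sup_bot_eq] at h3
    exact hne (point_eq_of_le h3)
  · rw [Finset.disjoint_left]
    intro Q hQ hQ'
    simp only [Finset.mem_biUnion, Finset.mem_sdiff] at hQ'
    obtain ⟨R, -, -, h⟩ := hQ'
    exact h hQ

theorem cnt_eq_card_pts {K : Finset (ℙ L E)} {Z : Submodule L E}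
    (h : ∀ P : ℙ L E, P.submodule ≤ Z → P ∈ K) :
    cnt K Z = gs (Fintype.card L) (finrank L Z) := by
  classical
  rw [← card_pts, cnt]
  congr 1
  ext P
  simp only [Finset.mem_filter, mem_pts]
  exact ⟨And.right, fun hP => ⟨h P hP, hP⟩⟩

/-- The number of points of a cone in terms of the number of points of its base. -/
theorem cnt_sup_vertex (K : Finset (ℙ L E)) {V Z : Submodule L E} (hVZ : V ⊓ Z = ⊥)
    (hVK : pts V ⊆ K)
    (hper : ∀ P Q : ℙ L E, V ⊔ P.submodule = V ⊔ Q.submodule → (P ∈ K ↔ Q ∈ K)) :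
    cnt K (V ⊔ Z) = gs (Fintype.card L) (finrank L V) +
      Fintype.card L ^ finrank L V * cnt K Z := by
  classical
  have hV := cnt_eq_card_pts fun P hP => hVK (mem_pts.2 hP)
  have hZ : cnt K Z = ∑ R ∈ pts Z, if R ∈ K then 1 else 0 := by
    rw [Finset.sum_boole, Nat.cast_id, cnt]
    congr 1
    ext P
    simp only [Finset.mem_filter, mem_pts]
    exact and_comm
  rw [cnt_sup_eq_sum K hVZ, hV, hZ, Finset.mul_sum]
  congr 1
  refine Finset.sum_congr rfl fun R hR => ?_
  have hRV : ¬ R.submodule ≤ V := by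
    intro h2
    have h3 := le_inf h2 (mem_pts.1 hR)
    rw [hVZ] at h3
    have := R.finrank_submodule
    rw [le_bot_iff.1 h3, finrank_bot] at this
    omega
  have hiff : ∀ P : ℙ L E, P.submodule ≤ V ⊔ R.submodule → ¬ P.submodule ≤ V →
      (P ∈ K ↔ R ∈ K) := fun P hP hPV => hper P R <|
    le_antisymm (sup_le le_sup_left hP) (sup_le le_sup_left (sup_point_exchange hPV hRV hP))
  split_ifs with hRK
  · rw [cnt_eq_card_pts, finrank_sup_point hRV, gs_succ, Nat.add_sub_cancel_left, mul_one]
    intro P hP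
    by_cases hPV : P.submodule ≤ V
    · exact hVK (mem_pts.2 hPV)
    · exact (hiff P hP hPV).2 hRK
  · rw [mul_zero, ← hV, Nat.sub_eq_zero_iff_le]
    apply Finset.card_le_card
    intro P hP
    rw [Finset.mem_filter] at hP ⊢
    exact ⟨hP.1, by_contra fun hPV => hRK ((hiff P hP.2 hPV).1 hP.1)⟩

theorem exists_hyp_eq {Z : Submodule L E} (hZ : finrank L Z + 1 = finrank L E) :
    ∃ h : ℙ L (Dual L E), h.submodule.dualCoannihilator = Z := by
  have h1 : finrank L Z.dualAnnihilator = 1 := by rw [finrank_dualAnn]; omega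
  refine ⟨Projectivization.mk'' _ h1, ?_⟩
  rw [Projectivization.submodule_mk'', Subspace.dualAnnihilator_dualCoannihilator_eq]

/-- A set with the parameters of a Baer cone is a cone over a set with the parameters of a Baer
subgeometry. -/
theorem exists_cone_structure (K : Finset (ℙ L E)) {s t m k a b c : ℕ} (hs : 2 ≤ s)
    (hq : Fintype.card L = s ^ 2) (hn : finrank L E = 2 * t + m + 4)
    (hk : k = gs s (2 * t + 3) * (s ^ 2) ^ (m + 1) + gs (s ^ 2) (m + 1))
    (ha : a = gs s (2 * t + 1) * (s ^ 2) ^ (m + 1) + gs (s ^ 2) (m + 1))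
    (hb : b = gs s (2 * t + 3) * (s ^ 2) ^ m + gs (s ^ 2) m)
    (hc : c = gs s (2 * t + 2) * (s ^ 2) ^ (m + 1) + gs (s ^ 2) (m + 1))
    (hK : ∀ h, hcnt K h = a ∨ hcnt K h = b ∨ hcnt K h = c) (hab : a ≠ b) (hbc : b ≠ c)
    (hcard : K.card = k)
    (hext : (hypsWith K a).card + (hypsWith K c).card = gs (s ^ 2) (2 * t + 3)) :
    ∃ V W : Submodule L E, finrank L V = m + 1 ∧ finrank L W = 2 * t + 3 ∧ IsCompl V W ∧
      pts V ⊆ K ∧ (∀ P Q : ℙ L E, V ⊔ P.submodule = V ⊔ Q.submodule → (P ∈ K ↔ Q ∈ K)) ∧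
      cnt K W = gs s (2 * t + 3) ∧ ∀ Z ≤ W, finrank L Z = 2 * t + 2 →
        cnt K Z = gs s (2 * t + 1) ∨ cnt K Z = gs s (2 * t + 2) := by
  have hac : a ≠ c := by
    subst ha hc
    have h1 := gs_strictMono (show 0 < s by omega) (show 2 * t + 1 < 2 * t + 2 by omega)
    have h2 : 0 < (s ^ 2) ^ (m + 1) := by positivity
    have := Nat.mul_lt_mul_of_pos_right h1 h2
    omega
  obtain ⟨V, hVm, hV⟩ := exists_vertex K hs hq hn hk hb hK hab hbc hac hcard hext
  have hV' : ∀ h : ℙ L (Dual L E), ¬ V ≤ h.submodule.dualCoannihilator → hcnt K h = b :=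
    fun h hh => not_not.1 fun hne => hh ((hV h).2 hne)
  have hKb : K.card = Fintype.card L * b + 1 := by
    rw [hcard, hk, hb, hq, gs_succ' (s ^ 2)]; ring
  have hVK := vertex_subset K b (2 * t + 2) m (by omega) hVm hV' hKb
  have hper : ∀ P Q : ℙ L E, V ⊔ P.submodule = V ⊔ Q.submodule → (P ∈ K ↔ Q ∈ K) :=
    fun P Q h => mem_iff_of_sup_eq K b (2 * t + m + 2) (by omega) hV' h
  obtain ⟨W, hW⟩ := Submodule.exists_isCompl V
  have hWf := Submodule.finrank_add_eq_of_isCompl hW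
  have hpos : 0 < (s ^ 2) ^ (m + 1) := by positivity
  refine ⟨V, W, hVm, by omega, hW, hVK, hper, ?_, ?_⟩
  · have h1 := cnt_sup_vertex K hW.inf_eq_bot hVK hper
    rw [hW.sup_eq_top, cnt_top, hVm, hq, hcard, hk] at h1
    exact Nat.eq_of_mul_eq_mul_left hpos (by linarith)
  · intro Z hZW hZ
    have hVZ : V ⊓ Z = ⊥ := le_bot_iff.1 ((inf_le_inf_left V hZW).trans hW.inf_eq_bot.le)
    have h1 := cnt_sup_vertex K hVZ hVK hper
    have h2 := Submodule.finrank_sup_add_finrank_inf_eq V Z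
    rw [hVZ, finrank_bot] at h2
    obtain ⟨h, hh⟩ := exists_hyp_eq (Z := V ⊔ Z) (by omega)
    have h3 := (hV h).1 (hh ▸ le_sup_left)
    rw [← hh, ← hcnt, hVm, hq] at h1
    rcases hK h with h4 | h4 | h4
    · exact Or.inl (Nat.eq_of_mul_eq_mul_left hpos (by rw [h4, ha] at h1; linarith))
    · exact absurd h4 h3
    · exact Or.inr (Nat.eq_of_mul_eq_mul_left hpos (by rw [h4, hc] at h1; linarith))

end Cone

section LinesAndPlanes

set_option linter.unusedSectionVars false

open scoped LinearAlgebra.Projectivization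

variable {L : Type*} [Field L] [Fintype L] {E : Type*} [AddCommGroup E] [Module L E]
  [FiniteDimensional L E]

theorem point_inf_eq_bot {P : ℙ L E} {Z : Submodule L E} (h : ¬ P.submodule ≤ Z) :
    P.submodule ⊓ Z = ⊥ := by
  have h1 := finrank_sup_point h
  have h2 := Submodule.finrank_sup_add_finrank_inf_eq P.submodule Z
  rw [sup_comm, h1, P.finrank_submodule] at h2
  exact Submodule.finrank_eq_zero.1 (by omega)

/-- The lines joining a point to the points of a subspace, counted with the points they
contribute. -/
theorem cnt_point_sup (K : Finset (ℙ L E)) {P : ℙ L E} {Z : Submodule L E} (hP : P ∈ K)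
    (hPZ : ¬ P.submodule ≤ Z) :
    cnt K (P.submodule ⊔ Z) = 1 + ∑ R ∈ pts Z, (cnt K (P.submodule ⊔ R.submodule) - 1) := by
  rw [cnt_sup_eq_sum K (point_inf_eq_bot hPZ), cnt_point hP]

theorem two_le_cnt_sup {K : Finset (ℙ L E)} {P Q : ℙ L E} (hP : P ∈ K) (hQ : Q ∈ K)
    (hPQ : P ≠ Q) : 2 ≤ cnt K (P.submodule ⊔ Q.submodule) :=
  two_le_cnt hP hQ hPQ le_sup_left le_sup_right

theorem finrank_line {P Q : ℙ L E} (hPQ : P ≠ Q) :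
    finrank L (P.submodule ⊔ Q.submodule : Submodule L E) = 2 := by
  rw [finrank_sup_point fun h => hPQ (point_eq_of_le h).symm, P.finrank_submodule]

theorem cnt_eq_sum_ite (K : Finset (ℙ L E)) [DecidableEq (ℙ L E)] (Z : Submodule L E) :
    cnt K Z = ∑ R ∈ pts Z, if R ∈ K then 1 else 0 := by
  classical
  rw [Finset.sum_boole, Nat.cast_id, cnt]
  congr 1
  ext P
  simp only [Finset.mem_filter, mem_pts]
  exact and_comm

theorem le_cnt_point_sup (K : Finset (ℙ L E)) {P : ℙ L E} {Z : Submodule L E} (hP : P ∈ K)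
    (hPZ : ¬ P.submodule ≤ Z) {w : ℕ}
    (hw : ∀ l : Submodule L E, finrank L l = 2 → 2 ≤ cnt K l → w + 1 ≤ cnt K l) :
    1 + w * cnt K Z ≤ cnt K (P.submodule ⊔ Z) := by
  classical
  rw [cnt_point_sup K hP hPZ, cnt_eq_sum_ite, Finset.mul_sum]
  gcongr with R hR
  split_ifs with hRK
  · have hne : P ≠ R := by
      rintro rfl
      exact hPZ (mem_pts.1 hR)
    have := hw _ (finrank_line hne) (two_le_cnt_sup hP hRK hne)
    omega
  · simp

theorem exists_extension_cnt_le (K : Finset (ℙ L E)) (e : ℕ) (he : e ≤ finrank L E)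
    (hsmall : K.card < gs (Fintype.card L) (finrank L E + 1 - e)) (S : Submodule L E)
    (hS : finrank L S ≤ e) : ∃ T, S ≤ T ∧ finrank L T = e ∧ cnt K T ≤ cnt K S := by
  induction h : e - finrank L S generalizing S with
  | zero => exact ⟨S, le_rfl, by omega, le_rfl⟩
  | succ r ih =>
    obtain ⟨Q, -, hQS, hQ⟩ := exists_extension K (le_top (a := S)) (by rw [finrank_top]; omega)
    rw [cnt_top, finrank_top] at hQ
    have h1 : cnt K (S ⊔ Q.submodule) - cnt K S = 0 := by
      by_contra hne
      have h2 : gs (Fintype.card L) (finrank L E + 1 - e) ≤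
        gs (Fintype.card L) (finrank L E - finrank L S) := gs_mono _ (by omega)
      have h3 := Nat.le_mul_of_pos_left (gs (Fintype.card L) (finrank L E - finrank L S))
        (Nat.pos_of_ne_zero hne)
      omega
    have h2 := finrank_sup_point hQS
    obtain ⟨T, hT, hTe, hTc⟩ := ih (S ⊔ Q.submodule) (by omega) (by omega)
    exact ⟨T, le_sup_left.trans hT, hTe, by omega⟩

/-- A set of points with the size and the hyperplane intersection numbers of a Baer subgeometry
of rank `2 * t + 3`. -/
structure BaerLike (K : Finset (ℙ L E)) (s t : ℕ) : Prop where
  two_le : 2 ≤ s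
  four_le : 1 ≤ t → 4 ≤ s
  card_field : Fintype.card L = s ^ 2
  finrank_eq : finrank L E = 2 * t + 3
  card_eq : K.card = gs s (2 * t + 3)
  hcnt_eq : ∀ h, hcnt K h = gs s (2 * t + 1) ∨ hcnt K h = gs s (2 * t + 2)

namespace BaerLike

variable {K : Finset (ℙ L E)} {s t : ℕ}

theorem cnt_formula (hK : BaerLike K s t) (i j : ℕ) (ht : t = i + j) (Z : Submodule L E)
    (hZ : finrank L Z = j + 2 * i + 2) :
    ∃ N, cnt K Z = gs s (2 * i + 1) + s ^ (2 * i + 1) * N := by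
  have hs := hK.two_le
  have h1 := sum_hcnt K Z j (by rw [hZ, hK.finrank_eq]; omega)
  have h2 : ∀ h, hcnt K h = gs s (2 * t + 1) +
      if hcnt K h = gs s (2 * t + 2) then s ^ (2 * t + 1) else 0 := by
    intro h
    have h3 : gs s (2 * t + 2) = gs s (2 * t + 1) + s ^ (2 * t + 1) := gs_succ _ _
    have h4 : 0 < s ^ (2 * t + 1) := by positivity
    rcases hK.hcnt_eq h with h5 | h5
    · rw [if_neg (by omega), h5, add_zero]
    · rw [if_pos h5, h5, h3]
  rw [Finset.sum_congr rfl fun h _ => h2 h, Finset.sum_add_distrib, Finset.sum_const,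
    ← Finset.sum_filter, Finset.sum_const, smul_eq_mul, smul_eq_mul] at h1
  set N := ((pts Z.dualAnnihilator).filter fun h => hcnt K h = gs s (2 * t + 2)).card
  rw [card_hyps, hZ,
    hK.finrank_eq, hK.card_eq, hK.card_field, show 2 * t + 3 - (j + 2 * i + 2) = j + 1 by omega,
    gs_succ' _ j, gs_succ' s (2 * t + 2), gs_succ' s (2 * t + 1)] at h1
  refine ⟨N, mul_left_cancel₀ (show (s ^ 2) ^ j ≠ 0 by positivity)
    (b := cnt K Z) (c := gs s (2 * i + 1) + s ^ (2 * i + 1) * N) ?_⟩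
  have h3 : gs s (2 * t + 1) = (1 + s) * gs (s ^ 2) j + (s ^ 2) ^ j * gs s (2 * i + 1) := by
    rw [show 2 * t + 1 = 2 * j + (2 * i + 1) by omega, gs_add, gs_double, pow_mul]
  have h4 : s ^ (2 * t + 1) = (s ^ 2) ^ j * s ^ (2 * i + 1) := by
    rw [show 2 * t + 1 = 2 * j + (2 * i + 1) by omega, pow_add, pow_mul]
  rw [h4, h3] at h1
  linarith

theorem card_eq' (hK : BaerLike K s t) :
    K.card = 1 + (s ^ 2 + s) * gs (s ^ 2) (t + 1) := by
  rw [hK.card_eq, show 2 * t + 3 = 2 * (t + 1) + 1 by ring, gs_succ', gs_double]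
  ring

theorem exists_extension_one (hK : BaerLike K s t) (S : Submodule L E) (hS : finrank L S ≤ t + 1) :
    ∃ T, S ≤ T ∧ finrank L T = t + 2 ∧ cnt K T ≤ cnt K S + 1 := by
  have hs := hK.two_le
  have hE := hK.finrank_eq
  have hq := hK.card_field
  have hcard := hK.card_eq'
  have h2 : gs (s ^ 2) (t + 2) = s ^ 2 * gs (s ^ 2) (t + 1) + 1 := gs_succ' _ _
  have h3 : gs (s ^ 2) (t + 3) = s ^ 2 * gs (s ^ 2) (t + 2) + 1 := gs_succ' _ _
  have h0 : s ≤ s ^ 2 := Nat.le_self_pow (by norm_num) s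
  have hlt : s * gs (s ^ 2) (t + 1) ≤ s ^ 2 * gs (s ^ 2) (t + 1) := Nat.mul_le_mul_right _ h0
  obtain ⟨T, hST, hT, hTc⟩ := exists_extension_cnt_le K (t + 1) (by omega) (by
    rw [hE, hq, hcard, show 2 * t + 3 + 1 - (t + 1) = t + 3 by omega, h3, h2]
    have : 4 ≤ s ^ 2 := Nat.pow_le_pow_left hs 2
    nlinarith) S hS
  obtain ⟨Q, -, hQT, hQ⟩ := exists_extension K (le_top (a := T)) (by rw [finrank_top]; omega)
  rw [cnt_top, finrank_top, hT, hE, hq, show 2 * t + 3 - (t + 1) = t + 2 by omega, hcard] at hQ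
  refine ⟨T ⊔ Q.submodule, hST.trans le_sup_left, by rw [finrank_sup_point hQT, hT], ?_⟩
  by_contra! hgt
  have h4 := Nat.mul_le_mul_right (gs (s ^ 2) (t + 2))
    (show 2 ≤ cnt K (T ⊔ Q.submodule) - cnt K T by omega)
  have h5 : (s ^ 2 + s) * gs (s ^ 2) (t + 1) =
    s ^ 2 * gs (s ^ 2) (t + 1) + s * gs (s ^ 2) (t + 1) := by ring
  omega

theorem exists_extension_two (hK : BaerLike K s t) (S : Submodule L E) (hS : finrank L S ≤ t + 2)
    (hS0 : 0 < cnt K S) :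
    ∃ Y, S ≤ Y ∧ finrank L Y = t + 3 ∧ cnt K Y ≤ cnt K S + s ^ 2 + s + 1 := by
  have hs := hK.two_le
  have hE := hK.finrank_eq
  have hq := hK.card_field
  have hcard := hK.card_eq'
  obtain ⟨T, hST, hT, hTc⟩ : ∃ T, S ≤ T ∧ finrank L T = t + 2 ∧ cnt K T ≤ cnt K S + 1 := by
    rcases Nat.lt_or_ge (finrank L S) (t + 2) with h | h
    · exact hK.exists_extension_one S (by omega)
    · exact ⟨S, le_rfl, by omega, by omega⟩
  have hST' := cnt_mono K hST
  obtain ⟨Q, -, hQT, hQ⟩ := exists_extension K (le_top (a := T)) (by rw [finrank_top]; omega)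
  rw [cnt_top, finrank_top, hT, hE, hq, show 2 * t + 3 - (t + 2) = t + 1 by omega, hcard] at hQ
  refine ⟨T ⊔ Q.submodule, hST.trans le_sup_left, by rw [finrank_sup_point hQT, hT], ?_⟩
  have h1 : cnt K (T ⊔ Q.submodule) - cnt K T ≤ s ^ 2 + s := by
    refine Nat.le_of_mul_le_mul_right (c := gs (s ^ 2) (t + 1)) (by omega) ?_
    have : 0 < gs (s ^ 2) (t + 1) := gs_succ' (s ^ 2) t ▸ Nat.succ_pos _
    omega
  omega

/-- Lines with at least two points meet the set in Baer sublines. -/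
theorem cnt_line (hK : BaerLike K s t) (l : Submodule L E) (hl : finrank L l = 2)
    (hl2 : 2 ≤ cnt K l) : cnt K l = s + 1 := by
  have hs := hK.two_le
  have hE := hK.finrank_eq
  have hq := hK.card_field
  rcases Nat.eq_zero_or_pos t with rfl | ht
  · obtain ⟨h, hh⟩ := exists_hyp_eq (Z := l) (by omega)
    have h1 := hK.hcnt_eq h
    have h2 : gs s (2 * 0 + 1) = 1 := gs_one s
    have h3 : gs s (2 * 0 + 2) = 1 + s := by
      rw [show 2 * 0 + 2 = 1 + 1 from rfl, gs_succ, gs_one, pow_one]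
    rw [hcnt, hh, h2, h3] at h1
    omega
  · have hs4 := hK.four_le ht
    have one : ∀ l : Submodule L E, finrank L l = 2 → 2 ≤ cnt K l →
        ∃ T, l ≤ T ∧ cnt K l ≤ cnt K T ∧ cnt K T ≤ cnt K l + 1 ∧ ∃ N, cnt K T = 1 + s * N := by
      intro l hl hl2
      obtain ⟨T, hlT, hT, hTc⟩ := hK.exists_extension_one l (by omega)
      obtain ⟨N, hN⟩ := hK.cnt_formula 0 t (by omega) T (by omega)
      exact ⟨T, hlT, cnt_mono K hlT, hTc, N, by simpa [gs_one] using hN⟩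
    have low : ∀ l : Submodule L E, finrank L l = 2 → 2 ≤ cnt K l → (s - 1) + 1 ≤ cnt K l := by
      intro l hl hl2
      obtain ⟨T, -, h1, h2, N, hN⟩ := one l hl hl2
      have hN0 : 1 ≤ N := by
        rcases Nat.eq_zero_or_pos N with rfl | h
        · omega
        · exact h
      have := Nat.mul_le_mul_left s hN0
      omega
    have hle := cnt_le_card_pts K l
    rw [hl, hq, gs_succ, gs_one, pow_one] at hle
    have hlow := low l hl hl2
    have hlt : cnt K l < 2 * s := by
      obtain ⟨Y, hlY, hY, hYc⟩ := hK.exists_extension_two l (by omega) (by omega)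
      obtain ⟨j, rfl⟩ : ∃ j, t = 1 + j := ⟨t - 1, by omega⟩
      obtain ⟨N, hN⟩ := hK.cnt_formula 1 j rfl Y (by omega)
      have h3 : gs s (2 * 1 + 1) = 1 + s + s ^ 2 := by
        simp [gs, Finset.sum_range_succ]
      rw [h3] at hN
      have hN0 : N = 0 := by
        by_contra hne
        have h4 := Nat.mul_le_mul_left (s ^ (2 * 1 + 1)) (Nat.one_le_iff_ne_zero.2 hne)
        have h5 : s ^ (2 * 1 + 1) = s * s ^ 2 := by ring
        have h6 := Nat.mul_le_mul_right (s ^ 2) hs4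
        have h7 : 0 < s ^ 2 := by positivity
        omega
      rw [hN0, mul_zero, add_zero] at hN
      obtain ⟨R, hRK, hRY, hRl⟩ := exists_of_cnt_lt (show cnt K l < cnt K Y by omega)
      have h4 := le_cnt_point_sup K hRK hRl low
      have h5 := cnt_mono K (sup_le hRY hlY)
      by_contra! hge
      have h6 := Nat.mul_le_mul_left (s - 1) hge
      obtain ⟨r, rfl⟩ : ∃ r, s = r + 4 := ⟨s - 4, by omega⟩
      rw [show r + 4 - 1 = r + 3 by omega] at h4 h6
      nlinarith
    obtain ⟨T, hlT, h1, h2, N, hN⟩ := one l hl hl2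
    have hNlt : N < 2 := by
      by_contra! h
      have := Nat.mul_le_mul_left s h
      omega
    interval_cases N
    · omega
    · by_contra hne
      have hls : cnt K l = s := by omega
      obtain ⟨R, hRK, hRT, hRl⟩ := exists_of_cnt_lt (show cnt K l < cnt K T by omega)
      have h4 := le_cnt_point_sup K hRK hRl low
      have h5 := cnt_mono K (sup_le hRT hlT)
      obtain ⟨r, rfl⟩ : ∃ r, s = r + 4 := ⟨s - 4, by omega⟩
      rw [show r + 4 - 1 = r + 3 by omega, hls] at h4
      nlinarith

/-- Planes with three non-collinear points meet the set in Baer subplanes. -/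
theorem cnt_plane (hK : BaerLike K s t) {l : Submodule L E} (hl : finrank L l = 2)
    (hl2 : 2 ≤ cnt K l) {P : ℙ L E} (hP : P ∈ K) (hPl : ¬ P.submodule ≤ l) :
    cnt K (P.submodule ⊔ l) = 1 + s + s ^ 2 := by
  have hs := hK.two_le
  have hE := hK.finrank_eq
  have hq := hK.card_field
  have hdim := finrank_sup_point hPl
  rw [sup_comm, hl] at hdim
  have h3 : gs s 3 = 1 + s + s ^ 2 := by simp [gs, Finset.sum_range_succ]
  rcases Nat.eq_zero_or_pos t with rfl | ht
  · have htop : P.submodule ⊔ l = ⊤ := Submodule.eq_top_of_finrank_eq (by omega)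
    rw [htop, cnt_top, hK.card_eq, h3]
  · have hs4 := hK.four_le ht
    have hlines : ∀ l : Submodule L E, finrank L l = 2 → 2 ≤ cnt K l → s + 1 ≤ cnt K l :=
      fun l hl hl2 => (hK.cnt_line l hl hl2).ge
    have hlow := le_cnt_point_sup K hP hPl hlines
    rw [hK.cnt_line l hl hl2] at hlow
    have hup : cnt K (P.submodule ⊔ l) ≤ 1 + (s ^ 2 + 1) * s := by
      rw [cnt_point_sup K hP hPl]
      have h4 : (pts l).card = s ^ 2 + 1 := by
        rw [card_pts, hl, hq, gs_succ, gs_one, pow_one, add_comm]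
      rw [← h4, ← smul_eq_mul, ← Finset.sum_const]
      gcongr with R hR
      rcases Nat.lt_or_ge (cnt K (P.submodule ⊔ R.submodule)) 2 with h | h
      · omega
      · rw [hK.cnt_line _ (finrank_line _) h]
        · omega
        · rintro rfl
          exact hPl (mem_pts.1 hR)
    obtain ⟨Y, hpY, hY, hYc⟩ := hK.exists_extension_two (P.submodule ⊔ l) (by omega)
      (cnt_pos hP le_sup_left)
    obtain ⟨j, rfl⟩ : ∃ j, t = 1 + j := ⟨t - 1, by omega⟩
    obtain ⟨N, hN⟩ := hK.cnt_formula 1 j rfl Y (by omega)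
    have hYeq : cnt K Y = cnt K (P.submodule ⊔ l) := by
      refine le_antisymm (not_lt.1 fun hlt => ?_) (cnt_mono K hpY)
      obtain ⟨R, hRK, hRY, hRp⟩ := exists_of_cnt_lt hlt
      have h4 := le_cnt_point_sup K hRK hRp hlines
      have h5 := cnt_mono K (sup_le hRY hpY)
      have h6 := Nat.mul_le_mul_right (cnt K (P.submodule ⊔ l)) hs4
      nlinarith
    rw [show 2 * 1 + 1 = 3 from rfl, h3] at hN
    rcases Nat.eq_zero_or_pos N with rfl | hN0
    · rw [← hYeq, hN, mul_zero, add_zero]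
    · have h4 := Nat.mul_le_mul_left (s ^ 3) hN0
      have h5 : (s ^ 2 + 1) * s = s ^ 3 + s := by ring
      have h6 : 0 < s ^ 2 := by positivity
      omega

end BaerLike

end LinesAndPlanes

section Coordinates

set_option linter.unusedSectionVars false

open scoped LinearAlgebra.Projectivization

variable {L : Type*} [Field L] [Fintype L] {E : Type*} [AddCommGroup E] [Module L E]
  [FiniteDimensional L E]

/-- The vector `v` represents a point of `K`. -/
def Represents (K : Finset (ℙ L E)) (v : E) : Prop :=
  ∃ hv : v ≠ 0, Projectivization.mk L v hv ∈ K

theorem represents_smul_iff {K : Finset (ℙ L E)} {v : E} {a : L} (ha : a ≠ 0) :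
    Represents K (a • v) ↔ Represents K v := by
  have h : ∀ (h₁ : a • v ≠ 0) (h₂ : v ≠ 0),
      Projectivization.mk L (a • v) h₁ = Projectivization.mk L v h₂ := fun h₁ h₂ =>
    (Projectivization.mk_eq_mk_iff' L _ _ _ _).2 ⟨a, rfl⟩
  constructor
  · rintro ⟨h₁, hK⟩
    have h₂ : v ≠ 0 := fun h => h₁ (by rw [h, smul_zero])
    exact ⟨h₂, h h₁ h₂ ▸ hK⟩
  · rintro ⟨h₂, hK⟩
    have h₁ : a • v ≠ 0 := smul_ne_zero ha h₂
    exact ⟨h₁, (h h₁ h₂).symm ▸ hK⟩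

open scoped Classical in
/-- The points of `K` on the line through `x` and `y`, other than `y`, in affine coordinates. -/
def slopes (K : Finset (ℙ L E)) (x y : E) : Finset L :=
  Finset.univ.filter fun a => Represents K (x + a • y)

theorem mem_slopes {K : Finset (ℙ L E)} {x y : E} {a : L} :
    a ∈ slopes K x y ↔ Represents K (x + a • y) := by
  simp [slopes]

theorem represents_rep {K : Finset (ℙ L E)} {P : ℙ L E} (hP : P ∈ K) : Represents K P.rep :=
  ⟨P.rep_nonzero, by rwa [P.mk_rep]⟩

theorem mk_submodule_le_iff {v : E} (hv : v ≠ 0) {Z : Submodule L E} :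
    (Projectivization.mk L v hv).submodule ≤ Z ↔ v ∈ Z := by
  rw [Projectivization.submodule_mk, Submodule.span_singleton_le_iff_mem]

namespace BaerLike

variable {K : Finset (ℙ L E)} {s t : ℕ}

/-- A point of a line with two points of the set, collinear with two other points of the set,
belongs to the set. -/
theorem mem_of_collinear (hK : BaerLike K s t) {P Q R : ℙ L E} {l : Submodule L E}
    (hl : finrank L l = 2) (hl2 : 2 ≤ cnt K l) (hP : P ∈ K) (hPl : ¬ P.submodule ≤ l)
    (hQ : Q ∈ K) (hPQ : P ≠ Q) (hR : R.submodule ≤ l)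
    (hQR : Q.submodule ≤ P.submodule ⊔ R.submodule) : R ∈ K := by
  classical
  by_contra hRK
  have h1 := hK.cnt_plane hl hl2 hP hPl
  rw [cnt_point_sup K hP hPl] at h1
  have h2 : ∑ X ∈ pts l, ((if X ∈ K then 1 else 0) * s + if X = R then 1 else 0) ≤
      ∑ X ∈ pts l, (cnt K (P.submodule ⊔ X.submodule) - 1) := by
    refine Finset.sum_le_sum fun X hX => ?_
    by_cases hXK : X ∈ K
    · have hXR : X ≠ R := fun h => hRK (h ▸ hXK)
      have hPX : P ≠ X := by
        rintro rfl
        exact hPl (mem_pts.1 hX)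
      rw [if_pos hXK, if_neg hXR, hK.cnt_line _ (finrank_line hPX) (two_le_cnt_sup hP hXK hPX)]
      omega
    · rw [if_neg hXK]
      split_ifs with hXR
      · rw [hXR]
        have := two_le_cnt hP hQ hPQ (le_sup_left (b := R.submodule)) hQR
        omega
      · omega
  rw [Finset.sum_add_distrib, ← Finset.sum_mul, ← cnt_eq_sum_ite, Finset.sum_ite_eq',
    if_pos (mem_pts.2 hR), hK.cnt_line l hl hl2] at h2
  nlinarith

theorem represents_of_collinear (hK : BaerLike K s t) {x y w v : E} {α β : L}
    (hind : ∀ a b c : L, a • x + b • y + c • w = 0 → a = 0 ∧ b = 0 ∧ c = 0)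
    (hx : Represents K x) (hy : Represents K y) (hw : Represents K w) (hv : v = α • x + β • y)
    (hv0 : v ≠ 0) (hwv : Represents K (w + v)) : Represents K v := by
  obtain ⟨hx0, hx⟩ := hx
  obtain ⟨hy0, hy⟩ := hy
  obtain ⟨hw0, hw⟩ := hw
  obtain ⟨hwv0, hwv⟩ := hwv
  have hxy : Projectivization.mk L x hx0 ≠ Projectivization.mk L y hy0 := by
    intro h
    obtain ⟨a, ha⟩ := (Projectivization.mk_eq_mk_iff' L _ _ _ _).1 h
    have := hind 1 (-a) 0 (by rw [← ha]; module)
    exact one_ne_zero this.1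
  have hmem : ∀ u : E, u ∈ (Projectivization.mk L x hx0).submodule ⊔
      (Projectivization.mk L y hy0).submodule ↔ ∃ a b : L, a • x + b • y = u := by
    intro u
    rw [Projectivization.submodule_mk, Projectivization.submodule_mk, ← Submodule.span_insert,
      Submodule.mem_span_pair]
  refine ⟨hv0, hK.mem_of_collinear (finrank_line hxy) (two_le_cnt_sup hx hy hxy) hw ?_ hwv ?_ ?_
    ?_⟩
  · rw [mk_submodule_le_iff, hmem]
    rintro ⟨a, b, h⟩
    have := hind a b (-1) (by rw [h]; module)
    simp at this
  · intro h
    obtain ⟨a, ha⟩ := (Projectivization.mk_eq_mk_iff' L _ _ _ _).1 h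
    have h1 := hind (a * α) (a * β) (a - 1) (by
      have h2 : a • v + (a - 1) • w = 0 := by
        rw [sub_smul, one_smul]
        nth_rewrite 2 [← ha]
        module
      rw [← h2, hv]
      module)
    have ha1 : a = 1 := sub_eq_zero.1 h1.2.2
    rw [ha1, one_smul] at ha
    exact hv0 (by simpa using ha)
  · rw [mk_submodule_le_iff, hmem]
    exact ⟨α, β, hv.symm⟩
  · rw [mk_submodule_le_iff, Projectivization.submodule_mk, Projectivization.submodule_mk]
    exact add_mem (Submodule.mem_sup_left (Submodule.mem_span_singleton_self w))
      (Submodule.mem_sup_right (Submodule.mem_span_singleton_self v))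

theorem represents_add_add (hK : BaerLike K s t) {a b r : E}
    (hind : ∀ x y z : L, x • a + y • b + z • r = 0 → x = 0 ∧ y = 0 ∧ z = 0)
    (ha : Represents K a) (hb : Represents K b) (har : Represents K (a + r))
    (hbr : Represents K (b + r)) : Represents K (a + b + r) := by
  refine hK.represents_of_collinear (x := a + r) (y := b) (w := (-1 : L) • a) (α := 1) (β := 1)
    ?_ har hb ((represents_smul_iff (by simp)).2 ha) (by module) ?_ ?_
  · intro x y z h
    have h1 := hind (x - z) y x (by rw [← h]; module)
    obtain ⟨h2, h3, h4⟩ := h1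
    exact ⟨h4, h3, by rw [h4, zero_sub, neg_eq_zero] at h2; exact h2⟩
  · intro h
    exact one_ne_zero (hind 1 1 1 (by rw [← h]; module)).1
  · convert hbr using 1
    module

theorem card_represents_add (hK : BaerLike K s t) {x y : E}
    (hxy : ∀ a b : L, a • x + b • y = 0 → a = 0 ∧ b = 0) (hx : Represents K x)
    (hy : Represents K y) : (slopes K x y).card = s := by
  classical
  obtain ⟨hx0, hx⟩ := hx
  obtain ⟨hy0, hy⟩ := hy
  have hne : ∀ a : L, x + a • y ≠ 0 := by
    intro a h
    exact one_ne_zero (hxy 1 a (by rw [one_smul, h])).1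
  have hne' : Projectivization.mk L x hx0 ≠ Projectivization.mk L y hy0 := by
    intro h
    obtain ⟨a, ha⟩ := (Projectivization.mk_eq_mk_iff' L _ _ _ _).1 h
    exact one_ne_zero (hxy 1 (-a) (by rw [← ha]; module)).1
  have hl := hK.cnt_line _ (finrank_line hne') (two_le_cnt_sup hx hy hne')
  have hmem : ∀ u : E, u ∈ (Projectivization.mk L x hx0).submodule ⊔
      (Projectivization.mk L y hy0).submodule ↔ ∃ a b : L, a • x + b • y = u := by
    intro u
    rw [Projectivization.submodule_mk, Projectivization.submodule_mk, ← Submodule.span_insert,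
      Submodule.mem_span_pair]
  set l := (Projectivization.mk L x hx0).submodule ⊔ (Projectivization.mk L y hy0).submodule
  have hbij : (slopes K x y).card =
      ((K.filter fun P => P.submodule ≤ l).erase (Projectivization.mk L y hy0)).card := by
    refine Finset.card_bij (fun a _ => Projectivization.mk L (x + a • y) (hne a)) ?_ ?_ ?_
    · intro a ha
      obtain ⟨_, haK⟩ := mem_slopes.1 ha
      refine Finset.mem_erase.2 ⟨?_, Finset.mem_filter.2 ⟨haK, ?_⟩⟩
      · intro h
        obtain ⟨b, hb⟩ := (Projectivization.mk_eq_mk_iff' L _ _ _ _).1 h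
        exact one_ne_zero (hxy 1 (a - b) (by rw [sub_smul, hb]; module)).1
      · rw [mk_submodule_le_iff, hmem]
        exact ⟨1, a, by rw [one_smul]⟩
    · intro a _ b _ h
      obtain ⟨c, hc⟩ := (Projectivization.mk_eq_mk_iff' L _ _ _ _).1 h
      have h1 := hxy (c - 1) (c * b - a) (by
        have h2 : c • (x + b • y) - (x + a • y) = 0 := sub_eq_zero.2 hc
        rw [← h2]
        module)
      rw [sub_eq_zero.1 h1.1, one_mul] at h1
      exact (sub_eq_zero.1 h1.2).symm
    · intro P hP
      obtain ⟨hPy, hP⟩ := Finset.mem_erase.1 hP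
      obtain ⟨hPK, hPl⟩ := Finset.mem_filter.1 hP
      rw [submodule_le_iff_rep, hmem] at hPl
      obtain ⟨a, b, hab⟩ := hPl
      have ha : a ≠ 0 := by
        rintro rfl
        refine hPy ?_
        rw [← P.mk_rep, Projectivization.mk_eq_mk_iff']
        exact ⟨b, by rw [← hab, zero_smul, zero_add]⟩
      have hPeq : Projectivization.mk L (x + (a⁻¹ * b) • y) (hne _) = P := by
        rw [← P.mk_rep, Projectivization.mk_eq_mk_iff']
        exact ⟨a⁻¹, by rw [← hab, smul_add, smul_smul, smul_smul, inv_mul_cancel₀ ha, one_smul]⟩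
      refine ⟨a⁻¹ * b, mem_slopes.2 ⟨hne _, ?_⟩, hPeq⟩
      rwa [hPeq]
  rw [Finset.card_erase_of_mem (Finset.mem_filter.2 ⟨hy, le_sup_right⟩)] at hbij
  have hcnt : (K.filter fun P => P.submodule ≤ l).card = s + 1 := by
    rw [← hl, cnt]
  rw [hcnt] at hbij
  exact hbij

end BaerLike

end Coordinates

section Frames

set_option linter.unusedSectionVars false

open scoped LinearAlgebra.Projectivization

variable {L : Type*} [Field L] [Fintype L] {E : Type*} [AddCommGroup E] [Module L E]
  [FiniteDimensional L E]

theorem basis_coeffs_eq_zero {ι : Type*} (b : Basis ι L E) {i j k : ι} (hij : i ≠ j)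
    (hik : i ≠ k) (hjk : j ≠ k) (x y z : L) (h : x • b i + y • b j + z • b k = 0) :
    x = 0 ∧ y = 0 ∧ z = 0 := by
  classical
  have key : ∀ m, b.repr (x • b i + y • b j + z • b k) m = 0 := by
    intro m
    rw [h, map_zero, Finsupp.zero_apply]
  refine ⟨?_, ?_, ?_⟩
  · simpa [Finsupp.single_apply, hij.symm, hik.symm] using key i
  · simpa [Finsupp.single_apply, hij, hjk.symm] using key j
  · simpa [Finsupp.single_apply, hik, hjk] using key k

theorem basis_coeffs_eq_zero_pair {ι : Type*} (b : Basis ι L E) {i j : ι} (hij : i ≠ j)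
    (x y : L) (h : x • b i + y • b j = 0) : x = 0 ∧ y = 0 := by
  classical
  have key : ∀ m, b.repr (x • b i + y • b j) m = 0 := by
    intro m
    rw [h, map_zero, Finsupp.zero_apply]
  refine ⟨?_, ?_⟩
  · simpa [Finsupp.single_apply, hij.symm] using key i
  · simpa [Finsupp.single_apply, hij] using key j

theorem card_filter_pow_eq_le [DecidableEq L] {s : ℕ} (hs : 1 < s) :
    (Finset.univ.filter fun x : L => x ^ s = x).card ≤ s := by
  have h0 := FiniteField.X_pow_card_sub_X_ne_zero L hs
  have h1 := FiniteField.X_pow_card_sub_X_natDegree_eq L hs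
  calc _ ≤ (Polynomial.X ^ s - Polynomial.X : Polynomial L).roots.toFinset.card := by
        refine Finset.card_le_card fun x hx => ?_
        rw [Multiset.mem_toFinset, Polynomial.mem_roots h0, Polynomial.IsRoot]
        simp [(Finset.mem_filter.1 hx).2]
    _ ≤ _ := Multiset.toFinset_card_le _
    _ ≤ _ := Polynomial.card_roots' _
    _ = s := h1

namespace BaerLike

variable {K : Finset (ℙ L E)} {s t : ℕ}

theorem exists_basis (hK : BaerLike K s t) :
    ∃ b : Basis (Fin (2 * t + 3)) L E, ∀ i, Represents K (b i) := by
  classical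
  have hs := hK.two_le
  have hspan : ⊤ ≤ Submodule.span L {v | Represents K v} := by
    by_contra hne
    have hlt : finrank L (Submodule.span L {v | Represents K v}) < finrank L E :=
      Submodule.finrank_lt fun h => hne h.ge
    obtain ⟨H, hH, hHdim, -⟩ := exists_extension_cnt_le (∅ : Finset (ℙ L E)) (finrank L E - 1)
      (by omega) (by
        rw [Finset.card_empty, show finrank L E + 1 - (finrank L E - 1) = 1 + 1 by omega, gs_succ']
        exact Nat.succ_pos _) _ (Nat.le_sub_one_of_lt hlt)
    obtain ⟨h, hh⟩ := exists_hyp_eq (Z := H) (by omega)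
    have h1 : cnt K H = K.card := by
      rw [cnt, Finset.filter_true_of_mem]
      intro P hP
      rw [submodule_le_iff_rep]
      exact hH (Submodule.subset_span (represents_rep hP))
    have h2 := hK.hcnt_eq h
    rw [hcnt, hh, h1, hK.card_eq] at h2
    have h3 := gs_strictMono (show 0 < s by omega) (show 2 * t + 1 < 2 * t + 3 by omega)
    have h4 := gs_strictMono (show 0 < s by omega) (show 2 * t + 2 < 2 * t + 3 by omega)
    omega
  let b := Basis.ofSpan hspan
  have : Fintype _ := FiniteDimensional.fintypeBasisIndex b
  have hcard := Module.finrank_eq_card_basis b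
  rw [hK.finrank_eq] at hcard
  refine ⟨b.reindex (Fintype.equivFinOfCardEq hcard.symm), fun i => ?_⟩
  rw [Basis.reindex_apply]
  exact Basis.ofSpan_subset hspan ⟨_, rfl⟩

theorem exists_frame (hK : BaerLike K s t) :
    ∃ b : Basis (Fin (2 * t + 3)) L E, (∀ i, Represents K (b i)) ∧
      ∀ i ≠ 0, Represents K (b 0 + b i) := by
  obtain ⟨b, hb⟩ := hK.exists_basis
  have hs := hK.two_le
  have key : ∀ i, ∃ a : L, a ≠ 0 ∧ (i = 0 → a = 1) ∧ (i ≠ 0 → Represents K (b 0 + a • b i)) := by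
    intro i
    by_cases hi : i = 0
    · exact ⟨1, one_ne_zero, fun _ => rfl, fun h => absurd hi h⟩
    · have h1 := hK.card_represents_add (basis_coeffs_eq_zero_pair b (Ne.symm hi)) (hb 0) (hb i)
      obtain ⟨a, ha, ha0⟩ := Finset.exists_mem_ne (show 1 < (slopes K (b 0) (b i)).card by omega) 0
      exact ⟨a, ha0, fun h => absurd h hi, fun _ => mem_slopes.1 ha⟩
  choose a ha ha0 ha1 using key
  refine ⟨b.unitsSMul fun i => Units.mk0 (a i) (ha i), fun i => ?_, fun i hi => ?_⟩
  · rw [Basis.unitsSMul_apply, Units.smul_mk0, represents_smul_iff (ha i)]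
    exact hb i
  · rw [Basis.unitsSMul_apply, Basis.unitsSMul_apply, Units.smul_mk0, Units.smul_mk0, ha0 0 rfl,
      one_smul]
    exact ha1 i hi

section

variable {b : Basis (Fin (2 * t + 3)) L E}

theorem represents_pair (hK : BaerLike K s t) (hb : ∀ i, Represents K (b i))
    {i j k : Fin (2 * t + 3)} (hki : k ≠ i) (hkj : k ≠ j) (hij : i ≠ j) {x y : L}
    (hx : x ∈ slopes K (b k) (b i)) (hy : y ∈ slopes K (b k) (b j)) (hx0 : x ≠ 0) :
    Represents K (x • b i + y • b j) := by
  rw [mem_slopes] at hx hy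
  have h1 : Represents K (b k + (x • b i + y • b j)) := by
    by_cases hy0 : y = 0
    · rwa [hy0, zero_smul, add_zero]
    · have h2 := hK.represents_add_add (a := x • b i) (b := y • b j) (r := b k) ?_
        ((represents_smul_iff hx0).2 (hb i)) ((represents_smul_iff hy0).2 (hb j))
        (by rwa [add_comm]) (by rwa [add_comm])
      · rwa [add_comm]
      · intro u v w h
        rw [smul_smul, smul_smul] at h
        simpa [hx0, hy0] using basis_coeffs_eq_zero b hij hki.symm hkj.symm _ _ _ h
  refine hK.represents_of_collinear (x := b i) (y := b j) (w := b k)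
    (basis_coeffs_eq_zero b hij hki.symm hkj.symm) (hb i) (hb j) (hb k) rfl ?_ h1
  intro h
  exact hx0 (basis_coeffs_eq_zero_pair b hij _ _ h).1

theorem div_mem_slopes (hK : BaerLike K s t) (hb : ∀ i, Represents K (b i))
    {i j k : Fin (2 * t + 3)} (hki : k ≠ i) (hkj : k ≠ j) (hij : i ≠ j) {x y : L}
    (hx : x ∈ slopes K (b k) (b i)) (hy : y ∈ slopes K (b k) (b j)) (hx0 : x ≠ 0) :
    x⁻¹ * y ∈ slopes K (b i) (b j) := by
  rw [mem_slopes, ← represents_smul_iff hx0, smul_add, smul_smul, mul_inv_cancel_left₀ hx0]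
  exact hK.represents_pair hb hki hkj hij hx hy hx0

theorem pow_eq_self_of_mem_slopes (hK : BaerLike K s t) (hb : ∀ i, Represents K (b i))
    (hb0 : ∀ i ≠ 0, Represents K (b 0 + b i)) {i : Fin (2 * t + 3)} (hi : i ≠ 0) {x : L}
    (hx : x ∈ slopes K (b 0) (b i)) : x ^ s = x := by
  classical
  have hs := hK.two_le
  rcases eq_or_ne x 0 with rfl | hx0
  · exact zero_pow (by omega)
  obtain ⟨j, hj0, hji⟩ : ∃ j : Fin (2 * t + 3), j ≠ 0 ∧ i ≠ j := by
    by_cases h : i = 1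
    · exact ⟨⟨2, by omega⟩, by simp [Fin.ext_iff], by rw [h]; simp [Fin.ext_iff]⟩
    · exact ⟨1, by simp, h⟩
  have hcard : ∀ k : Fin (2 * t + 3), k ≠ j → (slopes K (b k) (b j)).card = s := fun k hk =>
    hK.card_represents_add (basis_coeffs_eq_zero_pair b hk) (hb k) (hb j)
  have heq : slopes K (b 0) (b j) = slopes K (b i) (b j) := by
    refine Finset.eq_of_subset_of_card_le (fun y hy => ?_) ?_
    · have := hK.div_mem_slopes hb hi.symm hj0.symm hji (x := 1)
        (by rw [mem_slopes, one_smul]; exact hb0 i hi) hy one_ne_zero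
      rwa [inv_one, one_mul] at this
    · rw [hcard 0 hj0.symm, hcard i hji]
  set T := (slopes K (b 0) (b j)).erase 0
  have hT : T.card = s - 1 := by
    rw [Finset.card_erase_of_mem, hcard 0 hj0.symm]
    rw [mem_slopes, zero_smul, add_zero]
    exact hb 0
  have himg : T.image (fun y => x⁻¹ * y) = T := by
    refine Finset.eq_of_subset_of_card_le ?_ ?_
    · intro z hz
      obtain ⟨y, hy, rfl⟩ := Finset.mem_image.1 hz
      obtain ⟨hy0, hy⟩ := Finset.mem_erase.1 hy
      refine Finset.mem_erase.2 ⟨mul_ne_zero (inv_ne_zero hx0) hy0, ?_⟩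
      rw [heq]
      exact hK.div_mem_slopes hb hi.symm hj0.symm hji hx hy hx0
    · rw [Finset.card_image_of_injective _ (mul_right_injective₀ (inv_ne_zero hx0))]
  have hprod : ∏ y ∈ T, x⁻¹ * y = ∏ y ∈ T, y := by
    conv_rhs => rw [← himg]
    rw [Finset.prod_image fun _ _ _ _ h => mul_right_injective₀ (inv_ne_zero hx0) h]
  have hT0 : ∏ y ∈ T, y ≠ 0 := Finset.prod_ne_zero_iff.2 fun y hy => (Finset.mem_erase.1 hy).1
  rw [Finset.prod_mul_distrib, Finset.prod_const, hT] at hprod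
  have h1 : x⁻¹ ^ (s - 1) = 1 := mul_right_cancel₀ hT0 (by rw [hprod, one_mul])
  rw [inv_pow, inv_eq_one] at h1
  obtain ⟨r, rfl⟩ : ∃ r, s = r + 1 := ⟨s - 1, by omega⟩
  rw [Nat.add_sub_cancel] at h1
  rw [pow_succ, h1, one_mul]

theorem mem_slopes_iff (hK : BaerLike K s t) (hb : ∀ i, Represents K (b i))
    (hb0 : ∀ i ≠ 0, Represents K (b 0 + b i)) (F₀ : Subfield L) (hF₀ : Nat.card F₀ = s)
    {i : Fin (2 * t + 3)} (hi : i ≠ 0) {x : L} : x ∈ slopes K (b 0) (b i) ↔ x ∈ F₀ := by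
  classical
  have hs := hK.two_le
  have h1 : slopes K (b 0) (b i) = Finset.univ.filter fun x : L => x ^ s = x := by
    refine Finset.eq_of_subset_of_card_le (fun x hx => ?_) ?_
    · exact Finset.mem_filter.2 ⟨Finset.mem_univ _, hK.pow_eq_self_of_mem_slopes hb hb0 hi hx⟩
    · rw [hK.card_represents_add (basis_coeffs_eq_zero_pair b hi.symm) (hb 0) (hb i)]
      exact card_filter_pow_eq_le (s := s) (by omega)
  have h2 : (Finset.univ.filter fun x : L => x ∈ F₀) = Finset.univ.filter fun x : L => x ^ s = x := by
    rw [Nat.card_eq_fintype_card] at hF₀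
    refine Finset.eq_of_subset_of_card_le (fun x hx => ?_) ?_
    · have h3 := FiniteField.pow_card (⟨x, (Finset.mem_filter.1 hx).2⟩ : F₀)
      rw [hF₀] at h3
      exact Finset.mem_filter.2 ⟨Finset.mem_univ _, congrArg Subtype.val h3⟩
    · refine (card_filter_pow_eq_le (L := L) (s := s) (by omega)).trans (le_of_eq ?_)
      rw [← hF₀]
      exact Fintype.card_subtype _
  rw [h1, ← h2]
  simp

theorem represents_sum (hK : BaerLike K s t) (hb : ∀ i, Represents K (b i))
    (hb0 : ∀ i ≠ 0, Represents K (b 0 + b i)) (F₀ : Subfield L) (hF₀ : Nat.card F₀ = s)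
    (c : Fin (2 * t + 3) → L) (r : ℕ) (T : Finset (Fin (2 * t + 3))) (hT : T.card = r + 1)
    (hc : ∀ i ∈ T, c i ∈ F₀ ∧ c i ≠ 0) : Represents K (∑ i ∈ T, c i • b i) := by
  classical
  have hiff := fun (i : Fin (2 * t + 3)) (hi : i ≠ 0) (x : L) =>
    hK.mem_slopes_iff hb hb0 F₀ hF₀ hi (x := x)
  induction r using Nat.strong_induction_on generalizing T with
  | _ r ih =>
  rcases Nat.eq_zero_or_pos r with rfl | hr
  · obtain ⟨i, rfl⟩ := Finset.card_eq_one.1 hT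
    rw [Finset.sum_singleton, represents_smul_iff (hc i (by simp)).2]
    exact hb i
  obtain ⟨i, hi, j, hj, hij, hj0⟩ : ∃ i ∈ T, ∃ j ∈ T, i ≠ j ∧ j ≠ 0 := by
    obtain ⟨j, hj, hj0⟩ := Finset.exists_mem_ne (show 1 < T.card by omega) 0
    obtain ⟨i, hi, hij⟩ := Finset.exists_mem_ne (show 1 < T.card by omega) j
    exact ⟨i, hi, j, hj, hij, hj0⟩
  have hsum : ∑ i ∈ T, c i • b i =
      c i • b i + (c j • b j + ∑ k ∈ (T.erase i).erase j, c k • b k) := by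
    rw [Finset.add_sum_erase _ (fun k => c k • b k) (Finset.mem_erase.2 ⟨hij.symm, hj⟩),
      Finset.add_sum_erase _ (fun k => c k • b k) hi]
  have hcard : ((T.erase i).erase j).card = r - 1 := by
    rw [Finset.card_erase_of_mem (Finset.mem_erase.2 ⟨hij.symm, hj⟩), Finset.card_erase_of_mem hi]
    omega
  rw [hsum]
  rcases Nat.eq_or_lt_of_le (show 1 ≤ r from hr) with rfl | hr2
  · rw [Finset.card_eq_zero.1 hcard, Finset.sum_empty, add_zero]
    by_cases hi0 : i = 0
    · rw [hi0] at hi ⊢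
      rw [← represents_smul_iff (inv_ne_zero (hc 0 hi).2), smul_add, smul_smul, smul_smul,
        inv_mul_cancel₀ (hc 0 hi).2, one_smul, ← mem_slopes, hiff j hj0]
      exact mul_mem (inv_mem (hc 0 hi).1) (hc j hj).1
    · exact hK.represents_pair hb (Ne.symm hi0) hj0.symm hij ((hiff i hi0 _).2 (hc i hi).1)
        ((hiff j hj0 _).2 (hc j hj).1) (hc i hi).2
  · have hsub : ∀ k ∈ (T.erase i).erase j, c k ∈ F₀ ∧ c k ≠ 0 := fun k hk =>
      hc k (Finset.mem_of_mem_erase (Finset.mem_of_mem_erase hk))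
    obtain ⟨k, hk⟩ : ((T.erase i).erase j).Nonempty := Finset.card_pos.1 (by omega)
    set R := (T.erase i).erase j
    have hjR : j ∉ R := Finset.notMem_erase _ _
    have hiR : i ∉ R := fun h => Finset.notMem_erase _ _ (Finset.mem_of_mem_erase h)
    have hext : ∀ m ∈ T, m ∉ R → Represents K (c m • b m + ∑ k ∈ R, c k • b k) := by
      intro m hm hmR
      rw [← Finset.sum_insert (f := fun k => c k • b k) hmR]
      refine ih (r - 1) (by omega) _ (by rw [Finset.card_insert_of_notMem hmR]; omega) ?_
      intro l hl
      rcases Finset.mem_insert.1 hl with rfl | hl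
      · exact hc _ hm
      · exact hsub l hl
    rw [← add_assoc]
    refine hK.represents_add_add ?_ ((represents_smul_iff (hc i hi).2).2 (hb i))
      ((represents_smul_iff (hc j hj).2).2 (hb j)) (hext i hi hiR) (hext j hj hjR)
    intro x y z h
    have hrep : ∀ m, b.repr (∑ k ∈ R, c k • b k) m = if m ∈ R then c m else 0 := by
      intro m
      simp [Finsupp.single_apply]
    have key : ∀ m, x * (c i * if i = m then 1 else 0) + y * (c j * if j = m then 1 else 0) +
        z * (if m ∈ R then c m else 0) = 0 := by
      intro m
      have := congrArg (fun v => b.repr v m) h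
      simpa only [map_add, map_smul, Finsupp.add_apply, Finsupp.smul_apply, hrep, Basis.repr_self,
        Finsupp.single_apply, smul_eq_mul, map_zero, Finsupp.zero_apply] using this
    have hki : i ≠ k := fun h => hiR (h ▸ hk)
    have hkj : j ≠ k := fun h => hjR (h ▸ hk)
    refine ⟨?_, ?_, ?_⟩
    · simpa [hij.symm, hiR, (hc i hi).2] using key i
    · simpa [hij, hjR, (hc j hj).2] using key j
    · simpa [hki, hkj, hk, (hsub k hk).2] using key k

end

/-- The points of a set as above are the points of a Baer subgeometry. -/
theorem exists_baer_frame (hK : BaerLike K s t) (F₀ : Subfield L) (hF₀ : Nat.card F₀ = s) :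
    ∃ b : Basis (Fin (2 * t + 3)) L E, ∀ P, P ∈ K ↔ ∃ c : Fin (2 * t + 3) → L,
      (∀ i, c i ∈ F₀) ∧ ∃ h : ∑ i, c i • b i ≠ 0, P = Projectivization.mk L _ h := by
  classical
  have hs := hK.two_le
  obtain ⟨b, hb, hb0⟩ := hK.exists_frame
  refine ⟨b, ?_⟩
  have hne : ∀ c : {c : Fin (2 * t + 3) → F₀ // c ≠ 0}, ∑ i, (c.1 i : L) • b i ≠ 0 := by
    intro c h
    refine c.2 (funext fun i => ?_)
    have := Fintype.linearIndependent_iff.1 b.linearIndependent _ h i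
    exact Subtype.ext this
  let f : {c : Fin (2 * t + 3) → F₀ // c ≠ 0} → ℙ L E := fun c => Projectivization.mk L _ (hne c)
  have hfK : ∀ c, f c ∈ K := by
    intro c
    obtain ⟨i, hi⟩ := Function.ne_iff.1 c.2
    have h1 := hK.represents_sum hb hb0 F₀ hF₀ (fun i => (c.1 i : L))
      ((Finset.univ.filter fun i => c.1 i ≠ 0).card - 1) (Finset.univ.filter fun i => c.1 i ≠ 0)
      (by
        have : 0 < (Finset.univ.filter fun i => c.1 i ≠ 0).card :=
          Finset.card_pos.2 ⟨i, by simpa using hi⟩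
        omega)
      (fun i hi => ⟨(c.1 i).2, by simpa using hi⟩)
    have h2 : ∑ i ∈ Finset.univ.filter (fun i => c.1 i ≠ 0), (c.1 i : L) • b i =
        ∑ i, (c.1 i : L) • b i := by
      refine Finset.sum_subset (Finset.subset_univ _) fun i _ hi => ?_
      have : c.1 i = 0 := by simpa using hi
      rw [this, ZeroMemClass.coe_zero, zero_smul]
    rw [h2] at h1
    exact h1.2
  have himg : Finset.univ.image f = K := by
    refine Finset.eq_of_subset_of_card_le ?_ ?_
    · intro P hP
      obtain ⟨c, -, rfl⟩ := Finset.mem_image.1 hP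
      exact hfK c
    · have hfib : ∀ P ∈ Finset.univ.image f,
          (Finset.univ.filter fun c => f c = P).card ≤ s - 1 := by
        intro P hP
        obtain ⟨c, -, rfl⟩ := Finset.mem_image.1 hP
        have hunits : (Finset.univ : Finset F₀ˣ).card = s - 1 := by
          rw [Finset.card_univ, Fintype.card_units, ← Nat.card_eq_fintype_card, hF₀]
        rw [← hunits]
        refine Finset.card_le_card_of_surjOn
          (fun a => ⟨(a : F₀) • c.1, smul_ne_zero a.ne_zero c.2⟩) ?_
        intro d hd
        have hd : f d = f c := by simpa using hd
        obtain ⟨a, ha⟩ := (Projectivization.mk_eq_mk_iff' L _ _ _ _).1 hd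
        have hcoef : ∀ i, a * (c.1 i : L) = d.1 i := by
          intro i
          rw [Finset.smul_sum] at ha
          have h1 := congrArg (fun v => b.repr v i) ha
          simpa [Finsupp.single_apply] using h1
        obtain ⟨i, hi⟩ := Function.ne_iff.1 c.2
        have hiL : (c.1 i : L) ≠ 0 := by simpa using hi
        have ha0 : a ≠ 0 := by
          rintro rfl
          refine d.2 (funext fun j => Subtype.ext ?_)
          rw [← hcoef j, zero_mul]
          rfl
        have haF : a ∈ F₀ := by
          rw [eq_div_of_mul_eq hiL (hcoef i)]
          exact div_mem (d.1 i).2 (c.1 i).2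
        refine ⟨Units.mk0 ⟨a, haF⟩ fun h => ha0 (congrArg Subtype.val h), by simp, ?_⟩
        exact Subtype.ext (funext fun j => Subtype.ext (hcoef j))
      have h1 := Finset.card_le_mul_card_image Finset.univ (s - 1) hfib
      have h2 : (Finset.univ : Finset {c : Fin (2 * t + 3) → F₀ // c ≠ 0}).card =
          s ^ (2 * t + 3) - 1 := by
        rw [Finset.card_univ, Fintype.card_subtype_compl, Fintype.card_fun,
          Fintype.card_subtype_eq, Fintype.card_fin, ← Nat.card_eq_fintype_card, hF₀]
      have h3 : (s - 1) * gs s (2 * t + 3) = s ^ (2 * t + 3) - 1 := by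
        rw [gs, mul_comm, Nat.geomSum_eq hs]
        exact Nat.div_mul_cancel (Nat.sub_one_dvd_pow_sub_one _ _)
      rw [h2, ← h3] at h1
      rw [hK.card_eq]
      exact Nat.le_of_mul_le_mul_left h1 (by omega)
  intro P
  rw [← himg, Finset.mem_image]
  constructor
  · rintro ⟨c, -, rfl⟩
    exact ⟨fun i => c.1 i, fun i => (c.1 i).2, hne c, rfl⟩
  · rintro ⟨c, hc, h, rfl⟩
    refine ⟨⟨fun i => ⟨c i, hc i⟩, fun h0 => h ?_⟩, Finset.mem_univ _, rfl⟩
    refine Finset.sum_eq_zero fun i _ => ?_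
    have : c i = 0 := congrArg Subtype.val (congrFun h0 i)
    rw [this, zero_smul]

end BaerLike

end Frames

section Cones

set_option linter.unusedSectionVars false

open scoped LinearAlgebra.Projectivization

variable {L : Type*} [Field L] [Fintype L] {E : Type*} [AddCommGroup E] [Module L E]
  [FiniteDimensional L E]

open scoped Classical in
/-- The points of `K` in `W`, as points of the projective space of `W`. -/
def restrictPts (K : Finset (ℙ L E)) (W : Submodule L E) : Finset (ℙ L W) :=
  (pts (⊤ : Submodule L W)).filter fun P =>
    Projectivization.map W.subtype W.subtype_injective P ∈ K

theorem mem_restrictPts {K : Finset (ℙ L E)} {W : Submodule L E} {P : ℙ L W} :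
    P ∈ restrictPts K W ↔ Projectivization.map W.subtype W.subtype_injective P ∈ K := by
  simp [restrictPts]

theorem submodule_map_subtype {W : Submodule L E} (P : ℙ L W) :
    (Projectivization.map W.subtype W.subtype_injective P).submodule =
      P.submodule.map W.subtype := by
  induction P using Projectivization.ind with
  | h v hv =>
    rw [Projectivization.map_mk, Projectivization.submodule_mk, Projectivization.submodule_mk,
      Submodule.map_span, Set.image_singleton]

theorem exists_map_subtype_eq {W : Submodule L E} {P : ℙ L E} (hP : P.submodule ≤ W) :
    ∃ Q : ℙ L W, Projectivization.map W.subtype W.subtype_injective Q = P := by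
  rw [submodule_le_iff_rep] at hP
  refine ⟨Projectivization.mk L ⟨P.rep, hP⟩ fun h => P.rep_nonzero (congrArg Subtype.val h), ?_⟩
  rw [Projectivization.map_mk]
  exact P.mk_rep

theorem cnt_restrictPts (K : Finset (ℙ L E)) (W : Submodule L E) (Z : Submodule L W) :
    cnt (restrictPts K W) Z = cnt K (Z.map W.subtype) := by
  classical
  have hle : ∀ P : ℙ L W, (Projectivization.map W.subtype W.subtype_injective P).submodule ≤
      Z.map W.subtype ↔ P.submodule ≤ Z := by
    intro P
    rw [submodule_map_subtype, Submodule.map_le_map_iff_of_injective W.subtype_injective]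
  refine Finset.card_bij (fun P _ => Projectivization.map W.subtype W.subtype_injective P) ?_ ?_ ?_
  · intro P hP
    obtain ⟨h1, h2⟩ := Finset.mem_filter.1 hP
    exact Finset.mem_filter.2 ⟨mem_restrictPts.1 h1, (hle P).2 h2⟩
  · intro P _ Q _ h
    exact Projectivization.map_injective _ W.subtype_injective h
  · intro P hP
    obtain ⟨h1, h2⟩ := Finset.mem_filter.1 hP
    obtain ⟨Q, rfl⟩ := exists_map_subtype_eq (h2.trans (Submodule.map_subtype_le W Z))
    exact ⟨Q, Finset.mem_filter.2 ⟨mem_restrictPts.2 h1, (hle Q).1 h2⟩, rfl⟩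

theorem exists_subgeometry (K : Finset (ℙ L E)) {s t : ℕ} (hs : 2 ≤ s) (hs4 : 1 ≤ t → 4 ≤ s)
    (hq : Fintype.card L = s ^ 2) (F₀ : Subfield L) (hF₀ : Nat.card F₀ = s) {W : Submodule L E}
    (hW : finrank L W = 2 * t + 3) (hcard : cnt K W = gs s (2 * t + 3))
    (hhyp : ∀ Z ≤ W, finrank L Z = 2 * t + 2 →
      cnt K Z = gs s (2 * t + 1) ∨ cnt K Z = gs s (2 * t + 2)) :
    ∃ v : Fin (2 * t + 3) → E, LinearIndependent L v ∧ ∀ P : ℙ L E, P ∈ K ∧ P.submodule ≤ W ↔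
      ∃ c : Fin (2 * t + 3) → L, (∀ i, c i ∈ F₀) ∧ ∃ h : ∑ i, c i • v i ≠ 0,
        P = Projectivization.mk L _ h := by
  have hB : BaerLike (restrictPts K W) s t := by
    refine ⟨hs, hs4, hq, hW, ?_, fun h => ?_⟩
    · rw [← cnt_top, cnt_restrictPts, Submodule.map_subtype_top, hcard]
    · have h1 := finrank_hyp h
      rw [hcnt, cnt_restrictPts]
      refine hhyp _ (Submodule.map_subtype_le _ _) ?_
      rw [Submodule.finrank_map_subtype_eq]
      omega
  obtain ⟨b, hb⟩ := hB.exists_baer_frame F₀ hF₀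
  have hsum : ∀ c : Fin (2 * t + 3) → L, ∑ i, c i • (b i : E) = (∑ i, c i • b i : W) := by
    intro c
    simp
  refine ⟨fun i => b i, b.linearIndependent.map' W.subtype W.ker_subtype, fun P => ⟨?_, ?_⟩⟩
  · rintro ⟨hPK, hPW⟩
    obtain ⟨Q, rfl⟩ := exists_map_subtype_eq hPW
    obtain ⟨c, hc, h, rfl⟩ := (hb Q).1 (mem_restrictPts.2 hPK)
    refine ⟨c, hc, fun h0 => h (Subtype.ext ((hsum c).symm.trans h0)), ?_⟩
    rw [Projectivization.map_mk]
    congr 1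
    exact (hsum c).symm
  · rintro ⟨c, hc, h, rfl⟩
    have h0 : ∑ i, c i • b i ≠ 0 := fun h1 => h (by rw [hsum, h1, ZeroMemClass.coe_zero])
    have h1 := mem_restrictPts.1 ((hb _).2 ⟨c, hc, h0, rfl⟩)
    rw [Projectivization.map_mk] at h1
    have h2 : Projectivization.mk L _ h = Projectivization.mk L (W.subtype (∑ i, c i • b i))
        (fun h2 => h0 (W.subtype_injective (h2.trans (map_zero _).symm))) := by
      congr 1
      exact hsum c
    rw [h2]
    refine ⟨h1, ?_⟩
    rw [mk_submodule_le_iff]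
    exact (∑ i, c i • b i : W).2

/-- A set which is a union of cosets of a subspace `V` contained in it is a cone with vertex `V`
over its intersection with a complement of `V`. -/
theorem mem_iff_of_vertex {K : Finset (ℙ L E)} {V W : Submodule L E} (hVW : V ⊔ W = ⊤)
    (hV : pts V ⊆ K) (hper : ∀ P Q : ℙ L E, V ⊔ P.submodule = V ⊔ Q.submodule → (P ∈ K ↔ Q ∈ K))
    (P : ℙ L E) :
    P ∈ K ↔ (P.submodule ≤ V ∨ P ∈ K ∧ P.submodule ≤ W) ∨
      ∃ Q, (Q ∈ K ∧ Q.submodule ≤ W) ∧ ∃ X : ℙ L E, X.submodule ≤ V ∧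
        P.submodule ≤ X.submodule ⊔ Q.submodule := by
  by_cases hPV : P.submodule ≤ V
  · exact iff_of_true (hV (mem_pts.2 hPV)) (Or.inl (Or.inl hPV))
  constructor
  · intro hP
    obtain ⟨R, hRW, hRV, hR⟩ := exists_point_of_le_sup (V := V) (Z := W) (Q := P)
      (by rw [hVW]; exact le_top) hPV
    have hRK := (hper R P hR).2 hP
    by_cases hPR : P.submodule ≤ R.submodule
    · exact Or.inl (Or.inr ⟨hP, hPR.trans hRW⟩)
    · obtain ⟨X, hX, -, hXP⟩ := exists_point_of_le_sup (V := R.submodule) (Z := V) (Q := P)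
        (by rw [sup_comm, hR]; exact le_sup_right) hPR
      refine Or.inr ⟨R, ⟨hRK, hRW⟩, X, hX, ?_⟩
      rw [sup_comm, hXP]
      exact le_sup_right
  · rintro ((h | h) | ⟨Q, ⟨hQK, -⟩, X, hX, hP⟩)
    · exact absurd h hPV
    · exact h.1
    · obtain ⟨R, hRQ, -, hR⟩ := exists_point_of_le_sup (V := V) (Z := Q.submodule) (Q := P)
        (hP.trans (sup_le_sup_right hX _)) hPV
      rw [point_eq_of_le hRQ] at hR
      exact (hper Q P hR).1 hQK

end Cones

theorem cnum_eq_gs {q sq : ℕ} (hq : 2 ≤ q) (hsq : 2 ≤ sq) (vr s : ℕ) :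
    Cnum q sq vr s = gs sq (s + 1) * q ^ vr + gs q vr := by
  rw [Cnum, gs, gs, Nat.geomSum_eq hsq, Nat.geomSum_eq hq]

/-- In `PG(n,q)`, `n ≥ 4`, `q ≥ 16` a square prime power, `2 ≤ 2t ≤ n`,
every `(n-t)`-blocking set of type `(C_{n-2t-1,2t-2}, C_{n-2t-2,2t}, C_{n-2t-1,2t-1})_{n-1}`
is an `(n-2t-1, 2t)`-Baer cone; moreover for `t = 1` this holds for all square prime
powers `q ≥ 4`. -/
theorem statement4 [Fintype F] (p e q sq n t : ℕ) (hp : p.Prime) (he : 0 < e)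
    (hqdef : q = p ^ (2 * e)) (hsq : sq = p ^ e) (hq : Fintype.card F = q)
    (F₀ : Subfield F) (hF₀ : Nat.card F₀ = sq)
    (hn : 4 ≤ n) (ht1 : 2 ≤ 2 * t) (ht2 : 2 * t ≤ n)
    (hq16 : 16 ≤ q ∨ (t = 1 ∧ 4 ≤ q))
    (K : Set (PGPoint F n)) (hblock : BlocksDim F n t K)
    (hK : IsType3 F n K (Cnum q sq (n - 2 * t) (2 * t - 2))
      (Cnum q sq (n - 2 * t - 1) (2 * t)) (Cnum q sq (n - 2 * t) (2 * t - 1))) :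
    IsBaerCone F n F₀ (n - 2 * t) (2 * t) K := by
  obtain ⟨t, rfl⟩ : ∃ t', t = t' + 1 := ⟨t - 1, by omega⟩
  have hqs : q = sq ^ 2 := by rw [hqdef, hsq, mul_comm, pow_mul]
  have hs : 2 ≤ sq := by
    rw [hsq]
    exact hp.two_le.trans (Nat.le_self_pow he.ne' p)
  have hq2 : 2 ≤ q := by
    rw [hqs]
    exact hs.trans (Nat.le_self_pow (by norm_num) sq)
  have hs4 : 1 ≤ t → 4 ≤ sq := by
    intro ht
    have h16 : 16 ≤ q := by omega
    by_contra! h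
    rw [hqs] at h16
    nlinarith
  have hcard : Fintype.card F = sq ^ 2 := hq.trans hqs
  have hdim : finrank F (Fin (n + 1) → F) = n + 1 := by simp
  set K' : Finset (PGPoint F n) := (Set.toFinite K).toFinset with hK'
  have hmem : ∀ P, P ∈ K' ↔ P ∈ K := fun P => by simp [hK']
  have hncard : ∀ W, (K ∩ projSet F n W).ncard = cnt K' W := by
    intro W
    rw [cnt, ← Set.ncard_coe_finset]
    congr 1
    ext P
    simp [hmem, projSet]
  have hblock' : ∀ W : Submodule F (Fin (n + 1) → F), finrank F W = t + 2 → 0 < cnt K' W := by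
    intro W hW
    obtain ⟨P, hPK, hPW⟩ := hblock W hW
    exact cnt_pos ((hmem P).2 hPK) hPW
  obtain ⟨hall, hA, hB, hC⟩ := hK
  have hex : ∀ x, (∃ W : Submodule F (Fin (n + 1) → F), finrank F W = n ∧
      (K ∩ projSet F n W).ncard = x) → ∃ h, hcnt K' h = x := by
    rintro x ⟨W, hW, hx⟩
    obtain ⟨h, hh⟩ := exists_hyp_eq (Z := W) (by omega)
    exact ⟨h, by rw [hcnt, hh, ← hncard, hx]⟩
  have hall' : ∀ h, hcnt K' h = Cnum q sq (n - 2 * (t + 1)) (2 * (t + 1) - 2) ∨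
      hcnt K' h = Cnum q sq (n - 2 * (t + 1) - 1) (2 * (t + 1)) ∨
      hcnt K' h = Cnum q sq (n - 2 * (t + 1)) (2 * (t + 1) - 1) := by
    intro h
    have h1 := finrank_hyp h
    rw [hcnt, ← hncard]
    exact hall _ (by omega)
  replace hA := hex _ hA
  replace hB := hex _ hB
  replace hC := hex _ hC
  have ha : ∀ r, Cnum q sq r (2 * (t + 1) - 2) = gs sq (2 * t + 1) * (sq ^ 2) ^ r + gs (sq ^ 2) r :=
    fun r => by rw [cnum_eq_gs hq2 hs, hqs, show 2 * (t + 1) - 2 + 1 = 2 * t + 1 by omega]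
  have hb : ∀ r, Cnum q sq r (2 * (t + 1)) = gs sq (2 * t + 3) * (sq ^ 2) ^ r + gs (sq ^ 2) r :=
    fun r => by rw [cnum_eq_gs hq2 hs, hqs, show 2 * (t + 1) + 1 = 2 * t + 3 by omega]
  have hc : ∀ r, Cnum q sq r (2 * (t + 1) - 1) = gs sq (2 * t + 2) * (sq ^ 2) ^ r + gs (sq ^ 2) r :=
    fun r => by rw [cnum_eq_gs hq2 hs, hqs, show 2 * (t + 1) - 1 + 1 = 2 * t + 2 by omega]
  rw [ha] at hA
  rw [hb] at hB
  rw [hc] at hC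
  simp only [ha, hb, hc] at hall'
  rcases Nat.eq_zero_or_pos (n - 2 * (t + 1)) with hn0 | hn0
  · rw [hn0] at hA hB hC hall'
    exact (not_type_of_no_vertex K' (s := sq) (t := t) (hs4 (by omega)) (by omega) hcard (by omega)
      (by simp [gs_zero]) (by simp [gs_zero]) (by simp [gs_zero]) hblock' hall' hA hB hC).elim
  obtain ⟨m, hm⟩ : ∃ m, n - 2 * (t + 1) = m + 1 := ⟨n - 2 * (t + 1) - 1, by omega⟩
  rw [hm] at hA hB hC hall' ⊢
  rw [Nat.add_sub_cancel] at hB hall'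
  have hdim' : finrank F (Fin (n + 1) → F) = 2 * t + m + 4 := by omega
  have hcase : (m = 0 ∧ 1 ≤ t ∧ 4 ≤ sq) ∨ 1 ≤ m := by
    rcases Nat.eq_zero_or_pos m with hm0 | hm0
    · exact Or.inl ⟨hm0, by omega, hs4 (by omega)⟩
    · exact Or.inr hm0
  obtain ⟨hk, hext, hab, hbc⟩ := card_eq_cone K' hs hcard hdim' hcase rfl rfl rfl rfl hblock' hall'
    hA hB hC
  obtain ⟨V, W, hV, hW, hVW, hVK, hper, hWcard, hWhyp⟩ := exists_cone_structure K' hs hcard hdim'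
    rfl rfl rfl rfl hall' hab hbc hk hext
  obtain ⟨v, hv, hvK⟩ := exists_subgeometry K' hs hs4 hcard F₀ hF₀ hW hWcard hWhyp
  refine ⟨V, W, hV, by omega, hVW.inf_eq_bot, ⟨v, hv, ?_⟩, ?_⟩
  · ext P
    have := hvK P
    rw [hmem] at this
    exact this.trans ⟨fun ⟨c, hc, h, hP⟩ => ⟨c, hc, h, hP⟩, fun ⟨c, hc, h, hP⟩ => ⟨c, hc, h, hP⟩⟩
  · ext P
    have := mem_iff_of_vertex hVW.sup_eq_top hVK hper P
    simpa [projSet, hmem] using this
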